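/- Let v ≡ 0 (mod 6) and suppose (v,b) satisfies condition (C2). Then there exists an NWBTS(v;b). -/

import Mathlib

namespace DataPlacement

open Finset

variable {α : Type*} [DecidableEq α]

/-- Number of blocks of the family `F` (with multiplicity) containing `T`. -/
def lamF (F : Multiset (Finset α)) (T : Finset α) : ℕ :=
  Multiset.card (F.filter fun B => T ⊆ B)

/-- Triple system with `b` blocks on a point set `X` of size `v`. -/
def IsTSOn (X : Finset α) (v b : ℕ) (F : Multiset (Finset α)) : Prop :=
  X.card = v ∧ Multiset.card F = b ∧ ∀ B ∈ F, B.card = 3 ∧ B ⊆ X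

/-- `(l, e)` is the pair associated with `(v, b)`:
`3b = l·v(v−1)/2 + e` with `−v/2 < e < v/2`. -/
def AssocPair (v b l : ℕ) (e : ℤ) : Prop :=
  6 * (b : ℤ) = (l : ℤ) * v * ((v : ℤ) - 1) + 2 * e ∧
    -(v : ℤ) < 2 * e ∧ 2 * e < (v : ℤ)

/-- Condition (C1). -/
def CondC1 (v b : ℕ) : Prop :=
  v % 3 = 2 ∧ ∃ l : ℕ, 0 < l ∧
    ((v % 6 = 5 ∧ (l % 3 = 1 ∨ l % 3 = 2)) ∨
     (v % 6 = 2 ∧ (l % 6 = 2 ∨ l % 6 = 4))) ∧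
    (b = l * v * (v - 1) / 6 ∨ b = (l * v * (v - 1) + 5) / 6)

/-- Condition (C2). -/
def CondC2 (v b : ℕ) : Prop :=
  v % 2 = 0 ∧ ∃ l : ℕ, 0 < l ∧ l % 2 = 1 ∧
    (l : ℤ) * v * ((v : ℤ) - 1) - v < 6 * (b : ℤ) ∧
    6 * (b : ℤ) < (l : ℤ) * v * ((v : ℤ) - 1) + v

/-- Pairs of points of `X` whose block count equals `l + i`. -/
def Dlev (X : Finset α) (F : Multiset (Finset α)) (l : ℕ) (i : ℤ) :
    Finset (Finset α) :=
  (X.powersetCard 2).filter fun p => (lamF F p : ℤ) = (l : ℤ) + i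

/-- Every pair of points of `X` lies in `l−1`, `l`, or `l+1` blocks. -/
def PairRangeOn (X : Finset α) (F : Multiset (Finset α)) (l : ℕ) : Prop :=
  ∀ p ∈ X.powersetCard 2,
    (l : ℤ) - 1 ≤ (lamF F p : ℤ) ∧ (lamF F p : ℤ) ≤ (l : ℤ) + 1

def IsTriangle (D : Finset (Finset α)) : Prop :=
  ∃ x y z : α, x ≠ y ∧ x ≠ z ∧ y ≠ z ∧
    D = {({x, y} : Finset α), {y, z}, {x, z}}

def IsFourCycle (D : Finset (Finset α)) : Prop :=
  ∃ x y z w : α, x ≠ y ∧ x ≠ z ∧ x ≠ w ∧ y ≠ z ∧ y ≠ w ∧ z ≠ w ∧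
    D = {({x, y} : Finset α), {y, z}, {z, w}, {x, w}}

/-- `D` is a perfect matching on the point set `X`. -/
def IsPerfectMatchingOn (X : Finset α) (D : Finset (Finset α)) : Prop :=
  (∀ p ∈ D, p.card = 2 ∧ p ⊆ X) ∧ ∀ x ∈ X, ∃! p, p ∈ D ∧ x ∈ p

/-- Defect-graph shape required for nearly 2-balance under (C1). -/
def C1ShapeOn (X : Finset α) (F : Multiset (Finset α)) (l : ℕ) (e : ℤ) : Prop :=
  (e = 1 ∧ IsTriangle (Dlev X F l 1 ∪ Dlev X F l (-1)) ∧
     (Dlev X F l 1).card = 2 ∧ (Dlev X F l (-1)).card = 1) ∨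
  (e = -1 ∧ IsTriangle (Dlev X F l 1 ∪ Dlev X F l (-1)) ∧
     (Dlev X F l 1).card = 1 ∧ (Dlev X F l (-1)).card = 2) ∨
  (e = 2 ∧ IsFourCycle (Dlev X F l 1 ∪ Dlev X F l (-1)) ∧
     (Dlev X F l 1).card = 3 ∧ (Dlev X F l (-1)).card = 1) ∨
  (e = -2 ∧ IsFourCycle (Dlev X F l 1 ∪ Dlev X F l (-1)) ∧
     (Dlev X F l 1).card = 1 ∧ (Dlev X F l (-1)).card = 3)

/-- Defect-graph shape required for nearly 2-balance under (C2)
(here `v = X.card`). -/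
def C2ShapeOn (X : Finset α) (v : ℕ) (F : Multiset (Finset α)) (l : ℕ) (e : ℤ) : Prop :=
  (((v : ℤ) - 2 * e) % 4 = 0 ∧
    IsPerfectMatchingOn X (Dlev X F l 1 ∪ Dlev X F l (-1)) ∧
    4 * ((Dlev X F l 1).card : ℤ) = (v : ℤ) + 2 * e ∧
    4 * ((Dlev X F l (-1)).card : ℤ) = (v : ℤ) - 2 * e) ∨
  (((v : ℤ) - 2 * e) % 4 ≠ 0 ∧
    ∃ (c a₂ a₃ a₄ : α) (star : Finset (Finset α)),
      c ∈ X ∧ a₂ ∈ X ∧ a₃ ∈ X ∧ a₄ ∈ X ∧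
      c ≠ a₂ ∧ c ≠ a₃ ∧ c ≠ a₄ ∧ a₂ ≠ a₃ ∧ a₂ ≠ a₄ ∧ a₃ ≠ a₄ ∧
      star = {({c, a₂} : Finset α), {c, a₃}, {c, a₄}} ∧
      star ⊆ Dlev X F l 1 ∪ Dlev X F l (-1) ∧
      IsPerfectMatchingOn (X \ {c, a₂, a₃, a₄})
        ((Dlev X F l 1 ∪ Dlev X F l (-1)) \ star) ∧
      (((star ∩ Dlev X F l 1).card = 2 ∧ (star ∩ Dlev X F l (-1)).card = 1 ∧
          4 * (((Dlev X F l 1) \ star).card : ℤ) = (v : ℤ) - 6 + 2 * e ∧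
          4 * (((Dlev X F l (-1)) \ star).card : ℤ) = (v : ℤ) - 2 - 2 * e) ∨
        ((star ∩ Dlev X F l 1).card = 1 ∧ (star ∩ Dlev X F l (-1)).card = 2 ∧
          4 * (((Dlev X F l 1) \ star).card : ℤ) = (v : ℤ) - 2 + 2 * e ∧
          4 * (((Dlev X F l (-1)) \ star).card : ℤ) = (v : ℤ) - 6 - 2 * e)))

/-- `F` is 3-balanced on `X`: the multiplicities of any two triples of `X`
differ by at most one. -/
def ThreeBalancedOn (X : Finset α) (F : Multiset (Finset α)) : Prop :=
  ∀ T₁ ∈ X.powersetCard 3, ∀ T₂ ∈ X.powersetCard 3, F.count T₁ ≤ F.count T₂ + 1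

/-- Nearly well-balanced triple system NWBTS(v;b) on the point set `X`. -/
def IsNWBTSOn (X : Finset α) (v b : ℕ) (F : Multiset (Finset α)) : Prop :=
  IsTSOn X v b F ∧ ThreeBalancedOn X F ∧
  ∃ (l : ℕ) (e : ℤ), 0 < l ∧ AssocPair v b l e ∧ PairRangeOn X F l ∧
    ((CondC1 v b ∧ C1ShapeOn X F l e) ∨ (CondC2 v b ∧ C2ShapeOn X v F l e))

/-- `B` is an S_mu(2,3,·) design on the point set `X`. -/
def IsSDesignOn (X : Finset α) (mu : ℕ) (B : Multiset (Finset α)) : Prop :=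
  (∀ A ∈ B, A.card = 3 ∧ A ⊆ X) ∧ ∀ p ∈ X.powersetCard 2, lamF B p = mu

/-- `B` is a GDD_mu(2,3,·) of type `1^{·}u^1` on `X` with long group `U`. -/
def IsGDD1u (X : Finset α) (mu u : ℕ) (U : Finset α) (B : Multiset (Finset α)) : Prop :=
  U ⊆ X ∧ U.card = u ∧
  (∀ A ∈ B, A.card = 3 ∧ A ⊆ X ∧ (A ∩ U).card ≤ 1) ∧
  ∀ p ∈ X.powersetCard 2, ¬ p ⊆ U → lamF B p = mu

/-- `B` is a GDD_mu(2,3,·) with group family `G`. -/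
def IsGDDgroups (mu : ℕ) {n : ℕ} (G : Fin n → Finset α) (B : Multiset (Finset α)) : Prop :=
  (∀ A ∈ B, A.card = 3 ∧ A ⊆ Finset.univ.biUnion G ∧ ∀ i, (A ∩ G i).card ≤ 1) ∧
  ∀ x y : α, x ≠ y → (∃ i j, i ≠ j ∧ x ∈ G i ∧ y ∈ G j) → lamF B {x, y} = mu

/-- Nearly group divisible design NGDD(2,3,·) of type `2^{(m,n)}u^1` on `X`. -/
def IsNGDD (X : Finset α) (m n u : ℕ) (G : Fin (m + n) → Finset α) (U : Finset α)
    (B : Multiset (Finset α)) : Prop :=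
  (∀ i, (G i).card = 2 ∧ G i ⊆ X) ∧ U.card = u ∧ U ⊆ X ∧
  (∀ i j, i ≠ j → Disjoint (G i) (G j)) ∧ (∀ i, Disjoint (G i) U) ∧
  U ∪ Finset.univ.biUnion G = X ∧
  (∀ A ∈ B, A.card = 3 ∧ A ⊆ X) ∧
  (∀ i : Fin (m + n), (i : ℕ) < m → lamF B (G i) = 2) ∧
  (∀ i : Fin (m + n), m ≤ (i : ℕ) → lamF B (G i) = 0) ∧
  (∀ p ∈ U.powersetCard 2, lamF B p = 0) ∧
  (∀ p ∈ X.powersetCard 2, (∀ i, ¬ p ⊆ G i) → ¬ p ⊆ U → lamF B p = 1)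

/-- Candelabra system CS(g^n : s) on `X` with stem `S` and groups `G`. -/
def IsCS (X : Finset α) (g n s : ℕ) (S : Finset α) (G : Fin n → Finset α)
    (A : Multiset (Finset α)) : Prop :=
  S.card = s ∧ S ⊆ X ∧ (∀ i, (G i).card = g ∧ G i ⊆ X) ∧
  (∀ i j, i ≠ j → Disjoint (G i) (G j)) ∧ (∀ i, Disjoint (G i) S) ∧
  S ∪ Finset.univ.biUnion G = X ∧
  (∀ B ∈ A, B.card = 3 ∧ B ⊆ X) ∧
  (∀ T ∈ X.powersetCard 3, (∀ i, ¬ T ⊆ S ∪ G i) → lamF A T = 1) ∧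
  (∀ T ∈ X.powersetCard 3, (∃ i, T ⊆ S ∪ G i) → lamF A T = 0)

/-- Partitionable candelabra system PCS(g^n : s). -/
def IsPCS (X : Finset α) (g n s : ℕ) (S : Finset α) (G : Fin n → Finset α)
    (A : Multiset (Finset α)) : Prop :=
  IsCS X g n s S G A ∧
  ∃ (Ax : α → Multiset (Finset α)) (Ai : Fin (s - 2) → Multiset (Finset α)),
    A = (∑ p ∈ X \ S, Ax p) + ∑ i, Ai i ∧
    (∀ i : Fin n, ∀ p ∈ G i, IsGDD1u X 1 (g + s) (G i ∪ S) (Ax p)) ∧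
    (∀ j, IsGDDgroups 1 G (Ai j))

/-- g-PCS_2((2ag)^n : s). -/
def IsGPCS2 (X : Finset α) (a g n s : ℕ) (S : Finset α) (G : Fin n → Finset α)
    (A : Multiset (Finset α)) : Prop :=
  IsCS X (2 * a * g) n s S G A ∧
  ∃ (P : Fin (g * n) → Multiset (Finset α)) (grp : Fin (g * n) → Fin n),
    (∑ i, P i) ≤ A ∧
    (∀ j : Fin n, (Finset.univ.filter fun i => grp i = j).card = g) ∧
    (∀ i, IsGDD1u X 2 (2 * a * g + s) (G (grp i) ∪ S) (P i))

/-- g-PCS_2^r((2ag)^n : s). -/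
def IsGPCS2r (X : Finset α) (a g n s r : ℕ) (S : Finset α) (G : Fin n → Finset α)
    (A : Multiset (Finset α)) : Prop :=
  IsCS X (2 * a * g) n s S G A ∧
  ∃ (P : Fin (g * n) → Multiset (Finset α)) (grp : Fin (g * n) → Fin n),
    (∑ i, P i) ≤ A ∧
    (∀ j : Fin n, (Finset.univ.filter fun i => grp i = j).card = g) ∧
    (∀ i, IsGDD1u X 2 (2 * a * g + s) (G (grp i) ∪ S) (P i)) ∧
    ∃ (i : Fin (g * n)) (N : Multiset (Finset α))
      (Gs : Fin (r + (a * g * (n - 1) - r)) → Finset α),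
      N ≤ P i ∧ IsNGDD X r (a * g * (n - 1) - r) (2 * a * g + s) Gs (G (grp i) ∪ S) N

/-- GDD(3,3,·) of type `g^k` on `X` with groups `H`. -/
def IsGDD3On (X : Finset α) (g : ℕ) {k : ℕ} (H : Fin k → Finset α)
    (A : Multiset (Finset α)) : Prop :=
  (∀ i, (H i).card = g ∧ H i ⊆ X) ∧ (∀ i j, i ≠ j → Disjoint (H i) (H j)) ∧
  Finset.univ.biUnion H = X ∧
  (∀ B ∈ A, B.card = 3 ∧ B ⊆ X ∧ ∀ i, (B ∩ H i).card ≤ 1) ∧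
  (∀ T ∈ X.powersetCard 3, (∀ i, (T ∩ H i).card ≤ 1) → lamF A T = 1)

/-- `B` is a GDD_mu(2,3,·) on the points not in the omitted group `H o`,
with group set `{H i : i ≠ o}`. -/
def IsGDDOmit (mu : ℕ) {k : ℕ} (H : Fin k → Finset α) (o : Fin k)
    (B : Multiset (Finset α)) : Prop :=
  (∀ A ∈ B, A.card = 3 ∧ Disjoint A (H o) ∧ ∀ i, (A ∩ H i).card ≤ 1) ∧
  ∀ x y : α, x ≠ y →
    (∃ i j, i ≠ j ∧ i ≠ o ∧ j ≠ o ∧ x ∈ H i ∧ y ∈ H j) → lamF B {x, y} = mu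

/-- PGDD_2((2g)^{n+1}). -/
def IsPGDD2 (g n : ℕ) (H : Fin (n + 1) → Finset (Fin (2 * g * (n + 1))))
    (A : Multiset (Finset (Fin (2 * g * (n + 1))))) : Prop :=
  IsGDD3On Finset.univ (2 * g) H A ∧
  ∃ (i0 : Fin (n + 1))
    (P : Fin (g * n + 2 * g) → Multiset (Finset (Fin (2 * g * (n + 1)))))
    (f : Fin (g * n + 2 * g) → Fin (n + 1)),
    A = ∑ i, P i ∧
    (∀ j, j ≠ i0 → (Finset.univ.filter fun i => f i = j).card = g) ∧
    (∀ i, f i ≠ i0 → IsGDDOmit 2 H (f i) (P i)) ∧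
    (∀ i, f i = i0 → IsGDDOmit 1 H i0 (P i))

/-- 1-FG(3,(K1,KT),n) of type 1^n. -/
def Is1FG (n : ℕ) (K1 KT : Set ℕ) (A1 AT : Multiset (Finset (Fin n))) : Prop :=
  (∀ B ∈ A1, B.card ∈ K1) ∧ (∀ B ∈ AT, B.card ∈ KT) ∧
  (∀ p ∈ (Finset.univ : Finset (Fin n)).powersetCard 2, lamF A1 p = 1) ∧
  (∀ T ∈ (Finset.univ : Finset (Fin n)).powersetCard 3, lamF (A1 + AT) T = 1)

/-- PICS_2^r((2g)^3 : 0). -/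
def IsPICS2 (g r : ℕ) (G : Fin 3 → Finset (Fin (6 * g)))
    (A : Multiset (Finset (Fin (6 * g)))) : Prop :=
  IsCS Finset.univ (2 * g) 3 0 (∅ : Finset (Fin (6 * g))) G A ∧
  ∃ P : Fin (4 * g - 2) → Multiset (Finset (Fin (6 * g))),
    A = ∑ i, P i ∧
    (∀ i : Fin (4 * g - 2), (i : ℕ) < 2 * g → IsSDesignOn Finset.univ 2 (P i)) ∧
    (∃ i : Fin (4 * g - 2), (i : ℕ) < 2 * g ∧
      ∃ (N : Multiset (Finset (Fin (6 * g))))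
        (Gs : Fin (r + (3 * g - r)) → Finset (Fin (6 * g))),
        N ≤ P i ∧ IsNGDD Finset.univ r (3 * g - r) 0 Gs ∅ N) ∧
    (∀ i : Fin (4 * g - 2), 2 * g ≤ (i : ℕ) → IsGDDgroups 1 G (P i))

/-- Number of ordered pairs of blocks of `F` whose intersection has exactly
`j` points. -/
def interCount (F : Multiset (Finset α)) (j : ℕ) : ℕ :=
  Multiset.card
    ((F.bind fun A => F.map fun B => (A, B)).filter fun p => (p.1 ∩ p.2).card = j)

/-- The polynomial `P(F, x) = Σ_{j=0}^{3} v_j x^j`. -/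
noncomputable def Pval (F : Multiset (Finset α)) (x : ℝ) : ℝ :=
  ∑ j ∈ Finset.range 4, (interCount F j : ℝ) * x ^ j

/-- Optimal data placement for triple replication. -/
def IsOptimalDP (v b : ℕ) (F : Multiset (Finset (Fin v))) : Prop :=
  IsTSOn Finset.univ v b F ∧
  ∀ F' : Multiset (Finset (Fin v)), IsTSOn Finset.univ v b F' →
    ∀ x : ℝ, 1 ≤ x → Pval F x ≤ Pval F' x


set_option linter.unusedSimpArgs false

/-! ### Part 1: generic lemmas on triple systems -/

/-- The shape condition of `C2ShapeOn`, in terms of explicit defect sets. -/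
def ShapeD (X : Finset α) (v : ℕ) (e : ℤ) (D1 Dm : Finset (Finset α)) : Prop :=
  (((v : ℤ) - 2 * e) % 4 = 0 ∧
    IsPerfectMatchingOn X (D1 ∪ Dm) ∧
    4 * (D1.card : ℤ) = (v : ℤ) + 2 * e ∧
    4 * (Dm.card : ℤ) = (v : ℤ) - 2 * e) ∨
  (((v : ℤ) - 2 * e) % 4 ≠ 0 ∧
    ∃ (c a₂ a₃ a₄ : α) (star : Finset (Finset α)),
      c ∈ X ∧ a₂ ∈ X ∧ a₃ ∈ X ∧ a₄ ∈ X ∧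
      c ≠ a₂ ∧ c ≠ a₃ ∧ c ≠ a₄ ∧ a₂ ≠ a₃ ∧ a₂ ≠ a₄ ∧ a₃ ≠ a₄ ∧
      star = {({c, a₂} : Finset α), {c, a₃}, {c, a₄}} ∧
      star ⊆ D1 ∪ Dm ∧
      IsPerfectMatchingOn (X \ {c, a₂, a₃, a₄})
        ((D1 ∪ Dm) \ star) ∧
      (((star ∩ D1).card = 2 ∧ (star ∩ Dm).card = 1 ∧
          4 * ((D1 \ star).card : ℤ) = (v : ℤ) - 6 + 2 * e ∧
          4 * ((Dm \ star).card : ℤ) = (v : ℤ) - 2 - 2 * e) ∨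
        ((star ∩ D1).card = 1 ∧ (star ∩ Dm).card = 2 ∧
          4 * ((D1 \ star).card : ℤ) = (v : ℤ) - 2 + 2 * e ∧
          4 * ((Dm \ star).card : ℤ) = (v : ℤ) - 6 - 2 * e)))

lemma ShapeD.swap {X : Finset α} {v : ℕ} {e : ℤ} {D1 Dm : Finset (Finset α)}
    (h : ShapeD X v e D1 Dm) (hv : v % 2 = 0) : ShapeD X v (-e) Dm D1 := by
  rcases h with ⟨h0, h1, h2, h3⟩ | ⟨h0, c, a2, a3, a4, star, g1, g2, g3, g4, n1, n2, n3, n4, n5, n6,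
    hs, hsub, hm, hc⟩
  · left
    refine ⟨by omega, by rwa [union_comm], by linarith, by linarith⟩
  · right
    refine ⟨by omega, c, a2, a3, a4, star, g1, g2, g3, g4, n1, n2, n3, n4, n5, n6, hs,
      by rwa [union_comm], by rwa [union_comm], ?_⟩
    rcases hc with ⟨k1, k2, k3, k4⟩ | ⟨k1, k2, k3, k4⟩
    · right
      exact ⟨k2, k1, by linarith, by linarith⟩
    · left
      exact ⟨k2, k1, by linarith, by linarith⟩

lemma ShapeD.diff {X : Finset α} {v : ℕ} {e : ℤ} {D1 Dm : Finset (Finset α)}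
    (h : ShapeD X v e D1 Dm) : (D1.card : ℤ) - Dm.card = e := by
  rcases h with ⟨h0, h1, h2, h3⟩ | ⟨h0, c, a2, a3, a4, star, g1, g2, g3, g4, n1, n2, n3, n4, n5, n6,
    hs, hsub, hm, hc⟩
  · linarith
  · have e1 := card_sdiff_add_card_inter D1 star
    have e2 := card_sdiff_add_card_inter Dm star
    rw [inter_comm] at e1 e2
    rcases hc with ⟨k1, k2, k3, k4⟩ | ⟨k1, k2, k3, k4⟩ <;> rw [k1] at e1 <;> rw [k2] at e2 <;> omega

lemma lamF_add (F G : Multiset (Finset α)) (T : Finset α) :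
    lamF (F + G) T = lamF F T + lamF G T := by
  simp [lamF]

lemma lamF_nsmul (k : ℕ) (F : Multiset (Finset α)) (T : Finset α) :
    lamF (k • F) T = k * lamF F T := by
  simp [lamF, Multiset.filter_nsmul]

lemma sum_lamF [Fintype α] (F : Multiset (Finset α)) (hF : ∀ B ∈ F, B.card = 3) :
    ∑ p ∈ (univ : Finset α).powersetCard 2, lamF F p = 3 * Multiset.card F := by
  induction F using Multiset.induction_on with
  | empty => simp [lamF]
  | cons B F ih =>
    have h1 : ∀ p : Finset α, lamF (B ::ₘ F) p = (if p ⊆ B then 1 else 0) + lamF F p := by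
      intro p
      simp only [lamF, Multiset.filter_cons, Multiset.card_add]
      split_ifs <;> simp
    simp only [h1, sum_add_distrib]
    rw [ih (fun C hC => hF C (Multiset.mem_cons_of_mem hC))]
    have h2 : ((univ : Finset α).powersetCard 2).filter (fun p => p ⊆ B) = B.powersetCard 2 := by
      ext p
      simp [mem_powersetCard, and_comm]
    rw [← card_filter, h2, card_powersetCard, hF B (Multiset.mem_cons_self _ _)]
    simp [Nat.choose]
    ring

lemma lamF_finset (F : Finset (Finset α)) (p : Finset α) :
    lamF F.val p = (F.filter fun B => p ⊆ B).card := rfl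

lemma lamF_all [Fintype α] (p : Finset α) (hp : p ∈ (univ : Finset α).powersetCard 2) :
    lamF ((univ : Finset α).powersetCard 3).val p = Fintype.card α - 2 := by
  rw [lamF_finset]
  have hp2 := (mem_powersetCard.1 hp).2
  rw [← hp2, ← card_compl]
  symm
  apply card_bij (fun c _ => insert c p)
  · intro c hc
    simp only [mem_compl] at hc
    simp [mem_powersetCard, card_insert_of_notMem hc, hp2]
  · intro c hc d hd h
    simp only [mem_compl] at hc hd
    have : c ∈ insert d p := h ▸ mem_insert_self c p
    rcases mem_insert.1 this with h | h
    · exact h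
    · exact absurd h hc
  · intro T hT
    simp only [mem_filter, mem_powersetCard] at hT
    obtain ⟨⟨-, hT3⟩, hs⟩ := hT
    have h1 : (T \ p).card = 1 := by
      rw [card_sdiff_of_subset hs, hT3, hp2]
    obtain ⟨c, hc⟩ := card_eq_one.1 h1
    have hcm : c ∈ T \ p := by rw [hc]; simp
    refine ⟨c, by simpa using (mem_sdiff.1 hcm).2, ?_⟩
    rw [insert_eq, ← hc, sdiff_union_of_subset hs]

/-- A simple nearly 2-balanced system with index `l` and excess `e`. -/
def GoodSys (α : Type*) [DecidableEq α] [Fintype α] (v l : ℕ) (e : ℤ) : Prop :=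
  ∃ F D1 Dm : Finset (Finset α), (∀ T ∈ F, T.card = 3) ∧
    D1 ⊆ (univ : Finset α).powersetCard 2 ∧ Dm ⊆ (univ : Finset α).powersetCard 2 ∧
    Disjoint D1 Dm ∧
    (∀ p ∈ (univ : Finset α).powersetCard 2,
      (lamF F.val p : ℤ) = l + (if p ∈ D1 then 1 else 0) - (if p ∈ Dm then 1 else 0)) ∧
    ShapeD univ v e D1 Dm

lemma GoodSys.compl [Fintype α] {v l l' : ℕ} {e : ℤ} (h : GoodSys α v l e)
    (hv : v % 2 = 0) (hc : Fintype.card α = v) (hl : l + l' + 2 = v) : GoodSys α v l' (-e) := by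
  obtain ⟨F, D1, Dm, h3, s1, s2, hd, hlam, hs⟩ := h
  refine ⟨(univ : Finset α).powersetCard 3 \ F, Dm, D1, ?_, s2, s1, hd.symm, ?_, hs.swap hv⟩
  · intro T hT
    exact (mem_powersetCard.1 (mem_sdiff.1 hT).1).2
  · intro p hp
    have h1 := lamF_all p hp
    have h2 := hlam p hp
    rw [lamF_finset] at h1 h2
    rw [lamF_finset]
    have hF : F ⊆ (univ : Finset α).powersetCard 3 := by
      intro T hT
      simp [mem_powersetCard, h3 T hT]
    have h4 : ((univ : Finset α).powersetCard 3 \ F).filter (fun B => p ⊆ B) =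
        ((univ : Finset α).powersetCard 3).filter (fun B => p ⊆ B) \
          F.filter (fun B => p ⊆ B) := by
      ext T
      simp only [mem_filter, mem_sdiff]
      tauto
    have h5 : F.filter (fun B => p ⊆ B) ⊆
      ((univ : Finset α).powersetCard 3).filter (fun B => p ⊆ B) := filter_subset_filter _ hF
    have h6 := card_sdiff_add_card_eq_card h5
    rw [← h4] at h6
    omega

theorem reduction (h v b : ℕ) (hv : v = 6 * h) (hC2 : CondC2 v b)
    (H : ∀ (l : ℕ) (f : ℤ), l % 2 = 1 → l + 1 ≤ 3 * h → -(h : ℤ) < f → f < h →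
      GoodSys (Fin v) v l (3 * f)) :
    ∃ F : Multiset (Finset (Fin v)), IsNWBTSOn Finset.univ v b F := by
  have hC2' := hC2
  obtain ⟨-, l, hl0, hl1, hb1, hb2⟩ := hC2
  have hh : 0 < h := by
    rcases Nat.eq_zero_or_pos h with h0 | h0
    · subst h0; subst hv; simp at hb1 hb2; omega
    · exact h0
  set f : ℤ := (b : ℤ) - l * h * (6 * h - 1) with hf
  have hb : 6 * (b : ℤ) = (l : ℤ) * v * ((v : ℤ) - 1) + 2 * (3 * f) := by
    rw [hf, hv]; push_cast; ring
  have hf1 : -(h : ℤ) < f := by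
    have : (v : ℤ) = 6 * h := by exact_mod_cast hv
    linarith
  have hf2 : f < h := by
    have : (v : ℤ) = 6 * h := by exact_mod_cast hv
    linarith
  obtain ⟨k, l0, hl, hl0p, hl0lt⟩ : ∃ k l0, l = k * (v - 2) + l0 ∧ l0 % 2 = 1 ∧ l0 < v - 2 := by
    refine ⟨l / (v - 2), l % (v - 2), ?_, ?_, Nat.mod_lt _ (by omega)⟩
    · rw [mul_comm]; exact (Nat.div_add_mod _ _).symm
    · have h2 : 2 ∣ v - 2 := by omega
      rw [Nat.mod_mod_of_dvd _ h2]; exact hl1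
  have hG : GoodSys (Fin v) v l0 (3 * f) := by
    by_cases hc : l0 + 1 ≤ 3 * h
    · exact H l0 f hl0p hc hf1 hf2
    · have := (H (v - 2 - l0) (-f) (by omega) (by omega) (by omega) (by omega)).compl
        (l' := l0) (by omega) (by simp) (by omega)
      simpa using this
  obtain ⟨F, D1, Dm, h3, s1, s2, hd, hlam, hs⟩ := hG
  set A : Finset (Finset (Fin v)) := (univ : Finset (Fin v)).powersetCard 3 with hA
  have hlam' : ∀ p ∈ (univ : Finset (Fin v)).powersetCard 2,
      (lamF (k • A.val + F.val) p : ℤ) =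
        l + (if p ∈ D1 then 1 else 0) - (if p ∈ Dm then 1 else 0) := by
    intro p hp
    rw [lamF_add, lamF_nsmul, lamF_all p hp]
    have := hlam p hp
    push_cast
    rw [this, hl, Fintype.card_fin]
    push_cast
    ring
  have hB : ∀ B ∈ k • A.val + F.val, B.card = 3 := by
    intro B hB
    rcases Multiset.mem_add.1 hB with hB | hB
    · have := Multiset.mem_of_mem_nsmul hB
      exact (mem_powersetCard.1 (show B ∈ A from this)).2
    · exact h3 B hB
  have hD1 : Dlev univ (k • A.val + F.val) l 1 = D1 := by
    ext p
    simp only [Dlev, mem_filter]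
    constructor
    · rintro ⟨hp, he⟩
      rw [hlam' p hp] at he
      by_contra hn
      rw [if_neg hn] at he
      split_ifs at he <;> omega
    · intro hp
      refine ⟨s1 hp, ?_⟩
      rw [hlam' p (s1 hp), if_pos hp, if_neg (disjoint_left.1 hd hp)]
      ring
  have hDm : Dlev univ (k • A.val + F.val) l (-1) = Dm := by
    ext p
    simp only [Dlev, mem_filter]
    constructor
    · rintro ⟨hp, he⟩
      rw [hlam' p hp] at he
      by_contra hn
      rw [if_neg hn] at he
      split_ifs at he <;> omega
    · intro hp
      refine ⟨s2 hp, ?_⟩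
      rw [hlam' p (s2 hp), if_pos hp, if_neg (disjoint_right.1 hd hp)]
      ring
  refine ⟨k • A.val + F.val, ⟨by simp, ?_, fun B h => ⟨hB B h, subset_univ _⟩⟩, ?_,
    l, 3 * f, hl0, ⟨hb, by omega, by omega⟩, ?_, Or.inr ⟨hC2', ?_⟩⟩
  · have h1 := sum_lamF _ hB
    have h2 : ((∑ p ∈ (univ : Finset (Fin v)).powersetCard 2,
        lamF (k • A.val + F.val) p : ℕ) : ℤ) = l * ((v * (v - 1) / 2 : ℕ) : ℤ) + (D1.card - Dm.card) := by
      push_cast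
      rw [sum_congr rfl hlam', sum_sub_distrib, sum_add_distrib, sum_const, sum_ite_mem, sum_ite_mem,
        inter_eq_right.2 s1, inter_eq_right.2 s2, card_powersetCard, card_univ, Fintype.card_fin,
        Nat.choose_two_right]
      simp
      ring
    rw [h1, hs.diff] at h2
    have h4 : v * (v - 1) / 2 = 3 * h * (6 * h - 1) := by
      rw [hv, show 6 * h * (6 * h - 1) = 3 * h * (6 * h - 1) * 2 by ring]
      simp
    rw [h4] at h2
    have h5 : ((6 * h - 1 : ℕ) : ℤ) = 6 * h - 1 := by omega
    push_cast [h5] at h2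
    have h6 : (3 : ℤ) * (Multiset.card (k • A.val + F.val) : ℕ) = 3 * b := by
      rw [Multiset.card_add, Multiset.card_nsmul] 
      push_cast
      simp only [hf] at h2
      simp at h2 ⊢
      linarith
    omega
  · intro T1 hT1 T2 hT2
    have hc : ∀ T ∈ (univ : Finset (Fin v)).powersetCard 3,
        (k • A.val).count T = k ∧ F.val.count T ≤ 1 := by
      intro T hT
      refine ⟨?_, Multiset.nodup_iff_count_le_one.1 F.nodup T⟩
      rw [Multiset.count_nsmul, Multiset.count_eq_one_of_mem A.nodup hT, mul_one]
    rw [Multiset.count_add, Multiset.count_add]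
    have a1 := hc T1 hT1
    have a2 := hc T2 hT2
    omega
  · intro p hp
    rw [hlam' p hp]
    split_ifs <;> constructor <;> linarith
  · have : C2ShapeOn univ v (k • A.val + F.val) l (3 * f) ↔
        ShapeD univ v (3 * f) (Dlev univ (k • A.val + F.val) l 1)
          (Dlev univ (k • A.val + F.val) l (-1)) := Iff.rfl
    rw [this, hD1, hDm]
    exact hs


/-! ### Part 2: from symmetric ternary relations to systems -/

/-- A ternary relation describing a set of triples. -/
structure SymR {P : Type*} (R : P → P → P → Prop) : Prop where
  s1 : ∀ a b c, R a b c → R b a c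
  s2 : ∀ a b c, R a b c → R a c b
  ne : ∀ a b c, R a b c → a ≠ b

lemma SymR.distinct {P : Type*} {R : P → P → P → Prop} (h : SymR R) {a b c : P} (hr : R a b c) :
    a ≠ b ∧ a ≠ c ∧ b ≠ c :=
  ⟨h.ne _ _ _ hr, h.ne _ _ _ (h.s2 _ _ _ hr), h.ne _ _ _ (h.s2 _ _ _ (h.s1 _ _ _ hr))⟩

open scoped Classical in
/-- The set of triples given by a relation. -/
noncomputable def blk {P : Type*} [Fintype α] (q : P ≃ α) (R : P → P → P → Prop) :
    Finset (Finset α) :=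
  univ.filter fun T => ∃ a b c, R a b c ∧ T = {q a, q b, q c}

lemma mem_blk {P : Type*} [Fintype α] (q : P ≃ α) (R : P → P → P → Prop) (T : Finset α) :
    T ∈ blk q R ↔ ∃ a b c, R a b c ∧ T = {q a, q b, q c} := by
  simp [blk]

lemma blk_card {P : Type*} [Fintype α] (q : P ≃ α) {R : P → P → P → Prop} (hR : SymR R)
    (T : Finset α) (hT : T ∈ blk q R) : T.card = 3 := by
  obtain ⟨a, b, c, h, rfl⟩ := (mem_blk q R T).1 hT
  obtain ⟨h1, h2, h3⟩ := hR.distinct h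
  rw [card_eq_three]
  exact ⟨q a, q b, q c, by simpa, by simpa, by simpa, rfl⟩

open scoped Classical in
lemma lam_blk {P : Type*} [Fintype P] [Fintype α] (q : P ≃ α) {R : P → P → P → Prop}
    (hR : SymR R) (a b : P) (hab : a ≠ b) :
    lamF (blk q R).val {q a, q b} = (univ.filter fun c => R a b c).card := by
  rw [lamF_finset]
  symm
  apply card_bij (fun c _ => ({q a, q b, q c} : Finset α))
  · intro c hc
    rw [mem_filter] at hc
    rw [mem_filter, mem_blk]
    refine ⟨⟨a, b, c, hc.2, rfl⟩, ?_⟩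
    intro x
    simp only [mem_insert, mem_singleton]
    tauto
  · intro c hc d hd h
    rw [mem_filter] at hc hd
    obtain ⟨h1, h2, h3⟩ := hR.distinct hc.2
    have : q c ∈ ({q a, q b, q d} : Finset α) := by rw [← h]; simp
    simp only [mem_insert, mem_singleton, EmbeddingLike.apply_eq_iff_eq] at this
    rcases this with h | h | h
    · exact absurd h.symm h2
    · exact absurd h.symm h3
    · exact h
  · intro T hT
    rw [mem_filter, mem_blk] at hT
    obtain ⟨⟨x, y, z, hr, rfl⟩, hs⟩ := hT
    have ha : q a ∈ ({q x, q y, q z} : Finset α) := hs (by simp)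
    have hb : q b ∈ ({q x, q y, q z} : Finset α) := hs (by simp)
    simp only [mem_insert, mem_singleton, EmbeddingLike.apply_eq_iff_eq] at ha hb
    have r1 := hR.s1
    have r2 := hR.s2
    rcases ha with rfl | rfl | rfl <;> rcases hb with rfl | rfl | rfl
    · exact absurd rfl hab
    · exact ⟨z, by simp [hr], rfl⟩
    · exact ⟨y, by simp [r2 _ _ _ hr], by ext t; simp only [mem_insert, mem_singleton]; tauto⟩
    · exact ⟨z, by simp [r1 _ _ _ hr], by ext t; simp only [mem_insert, mem_singleton]; tauto⟩
    · exact absurd rfl hab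
    · exact ⟨x, by simp [r2 _ _ _ (r1 _ _ _ hr)],
        by ext t; simp only [mem_insert, mem_singleton]; tauto⟩
    · exact ⟨y, by simp [r1 _ _ _ (r2 _ _ _ hr)],
        by ext t; simp only [mem_insert, mem_singleton]; tauto⟩
    · exact ⟨x, by simp [r2 _ _ _ (r1 _ _ _ (r2 _ _ _ hr))],
        by ext t; simp only [mem_insert, mem_singleton]; tauto⟩
    · exact absurd rfl hab

lemma ncard_filter' {P : Type*} [Fintype P] (R : P → Prop) [DecidablePred R] :
    {c | R c}.ncard = (univ.filter fun c => R c).card := by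
  rw [← Set.ncard_coe_finset]
  simp

open scoped Classical in
theorem good_of_rel {P : Type*} [Fintype P] [Fintype α] (q : P ≃ α) (v : ℕ) (e : ℤ)
    (N : P → P → P → Prop) (E : ℕ → P → P → P → Prop) (K : ℕ)
    (hN : SymR N) (hE : ∀ k < K, SymR (E k))
    (hE2 : ∀ k < K, ∀ a b, a ≠ b → {c | E k a b c}.ncard = 2)
    (hx : ∀ j < K, ∀ k < K, j ≠ k → ∀ a b c, E j a b c → ¬ E k a b c)
    (hNx : ∀ k < K, ∀ a b c, N a b c → ¬ E k a b c)
    (D1 Dm : Finset (Finset α))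
    (s1 : D1 ⊆ (univ : Finset α).powersetCard 2) (s2 : Dm ⊆ (univ : Finset α).powersetCard 2)
    (hd : Disjoint D1 Dm)
    (hN2 : ∀ a b, a ≠ b → ({c | N a b c}.ncard : ℤ) =
      1 + (if {q a, q b} ∈ D1 then 1 else 0) - (if {q a, q b} ∈ Dm then 1 else 0))
    (hs : ShapeD univ v e D1 Dm) : GoodSys α v (2 * K + 1) e := by
  set R : P → P → P → Prop := fun a b c => N a b c ∨ ∃ k < K, E k a b c with hRdef
  have hR : SymR R := by
    constructor
    · rintro a b c (h | ⟨k, hk, h⟩)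
      · exact Or.inl (hN.s1 _ _ _ h)
      · exact Or.inr ⟨k, hk, (hE k hk).s1 _ _ _ h⟩
    · rintro a b c (h | ⟨k, hk, h⟩)
      · exact Or.inl (hN.s2 _ _ _ h)
      · exact Or.inr ⟨k, hk, (hE k hk).s2 _ _ _ h⟩
    · rintro a b c (h | ⟨k, hk, h⟩)
      · exact hN.ne _ _ _ h
      · exact (hE k hk).ne _ _ _ h
  refine ⟨blk q R, D1, Dm, blk_card q hR, s1, s2, hd, ?_, hs⟩
  intro p hp
  obtain ⟨x, y, hxy, rfl⟩ := card_eq_two.1 (mem_powersetCard.1 hp).2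
  obtain ⟨a, rfl⟩ := q.surjective x
  obtain ⟨b, rfl⟩ := q.surjective y
  have hab : a ≠ b := fun h => hxy (by rw [h])
  rw [lam_blk q hR a b hab]
  have h1 : ∀ inst : DecidablePred (fun c => R a b c), (@Finset.filter _ (fun c => R a b c) inst univ) =
      (univ.filter fun c => N a b c) ∪
        (range K).biUnion (fun k => univ.filter fun c => E k a b c) := by
    intro inst
    ext c
    simp [hRdef]
  have hE3 : ∀ k < K, (univ.filter fun c => E k a b c).card = 2 := by
    intro k hk
    rw [← ncard_filter', hE2 k hk a b hab]
  rw [h1, card_union_of_disjoint, card_biUnion]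
  · rw [sum_congr rfl (fun k hk => hE3 k (mem_range.1 hk))]
    push_cast
    rw [← ncard_filter', hN2 a b hab]
    simp
    ring
  · intro j hj k hk hjk
    rw [Function.onFun, disjoint_left]
    intro c hc hc'
    simp only [mem_filter, mem_univ, true_and] at hc hc'
    exact hx j (by simpa using hj) k (by simpa using hk) hjk a b c hc hc'
  · rw [disjoint_left]
    intro c hc hc'
    simp only [mem_filter, mem_univ, true_and, mem_biUnion, mem_range] at hc hc'
    obtain ⟨k, hk, h⟩ := hc'
    exact hNx k hk a b c hc h


/-! ### Part 3: the twofold designs -/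

/-- The algebraic data used: a group with an element `w` spanning the kernel of doubling, an
element `o` representing the nontrivial class modulo doubles, and a choice `p` of representatives
modulo `w`. -/
structure HS (W : Type*) [AddCommGroup W] where
  o : W
  w : W
  p : W → Bool
  hww : w + w = 0
  hw : w ≠ 0
  hker : ∀ x, x + x = 0 → x = 0 ∨ x = w
  ho : ∀ x, x + x ≠ o
  hcov : ∀ u, ∃ y, u = y + y ∨ u = y + y + o
  hp : ∀ z, p (z + w) = !p z

namespace HS

variable {W : Type*} [AddCommGroup W] (S : HS W)

/-- The twisted doubling bijection. -/
def psi (z : W) : W := z + z + if S.p z then S.o else 0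

lemma ker2 {x y : W} (h : x + x = y + y) : y = x ∨ y = x + S.w := by
  rcases S.hker (y - x) (by rw [show y - x + (y - x) = (y + y) - (x + x) by abel, h]; abel) with h | h
  · left; exact sub_eq_zero.1 h
  · right; rw [← h]; abel

lemma dbl_w (x : W) : (x + S.w) + (x + S.w) = x + x := by
  rw [show (x + S.w) + (x + S.w) = x + x + (S.w + S.w) by abel, S.hww, add_zero]

lemma o_ne (x y : W) : x + x ≠ y + y + S.o := by
  intro h
  apply S.ho (x - y)
  rw [show x - y + (x - y) = (x + x) - (y + y) by abel, h]; abel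

lemma o_ne_zero : S.o ≠ 0 := by
  intro h
  exact S.ho 0 (by rw [h]; simp)

lemma psi_inj {x y : W} (h : S.psi x = S.psi y) : x = y := by
  unfold psi at h
  have key : x + x = y + y → S.p x = S.p y → x = y := by
    intro h1 h2
    rcases S.ker2 h1 with h | h
    · exact h.symm
    · rw [h, S.hp] at h2
      cases hh : S.p x <;> simp [hh] at h2
  cases hx : S.p x <;> cases hy : S.p y <;> simp [hx, hy] at h
  · exact key h (by rw [hx, hy])
  · exact absurd h (S.o_ne _ _)
  · exact absurd h.symm (S.o_ne _ _)
  · exact key h (by rw [hx, hy])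

lemma exists_p (y : W) (b : Bool) : ∃ x, x + x = y + y ∧ S.p x = b := by
  by_cases h : S.p y = b
  · exact ⟨y, rfl, h⟩
  · refine ⟨y + S.w, S.dbl_w y, ?_⟩
    rw [S.hp]
    cases b <;> cases hh : S.p y <;> simp_all

lemma psi_surj (u : W) : ∃ z, S.psi z = u := by
  obtain ⟨y, hy⟩ := S.hcov u
  rcases hy with rfl | rfl
  · obtain ⟨x, hx, hp⟩ := S.exists_p y false
    exact ⟨x, by simp [psi, hp, hx]⟩
  · obtain ⟨x, hx, hp⟩ := S.exists_p y true
    exact ⟨x, by simp [psi, hp, hx]⟩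

/-- two points with the same double and the same `p` are equal -/
lemma eq_of_p {x y : W} (h : x + x = y + y) (hp : S.p x = S.p y) : x = y := by
  apply S.psi_inj
  simp [psi, h, hp]

end HS

/-- Closure of a ternary relation under permutations. -/
def sym3 {P : Type*} (R : P → P → P → Prop) (a b c : P) : Prop :=
  R a b c ∨ R a c b ∨ R b a c ∨ R b c a ∨ R c a b ∨ R c b a

lemma sym3_symR {P : Type*} {R : P → P → P → Prop}
    (h : ∀ a b c, R a b c → a ≠ b ∧ a ≠ c ∧ b ≠ c) : SymR (sym3 R) := by
  constructor
  · intro a b c; unfold sym3; tauto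
  · intro a b c; unfold sym3; tauto
  · intro a b c hs
    rcases hs with hs | hs | hs | hs | hs | hs
    · exact (h _ _ _ hs).1
    · exact (h _ _ _ hs).2.1
    · exact (h _ _ _ hs).1.symm
    · exact (h _ _ _ hs).2.1.symm
    · exact (h _ _ _ hs).2.2
    · exact (h _ _ _ hs).2.2.symm

lemma z11 (i : ZMod 3) : i + 1 + 1 = i + 2 := by revert i; decide
lemma z12 (i : ZMod 3) : i + 1 + 2 = i := by revert i; decide
lemma z21 (i : ZMod 3) : i + 2 + 1 = i := by revert i; decide
lemma z22 (i : ZMod 3) : i + 2 + 2 = i + 1 := by revert i; decide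
lemma y10 (i : ZMod 3) : (i + 1 = i) ↔ False := by revert i; decide
lemma y20 (i : ZMod 3) : (i + 2 = i) ↔ False := by revert i; decide
lemma y01 (i : ZMod 3) : (i = i + 1) ↔ False := by revert i; decide
lemma y02 (i : ZMod 3) : (i = i + 2) ↔ False := by revert i; decide
lemma y12 (i : ZMod 3) : (i + 1 = i + 2) ↔ False := by revert i; decide
lemma y21 (i : ZMod 3) : (i + 2 = i + 1) ↔ False := by revert i; decide
lemma lev3 (i k : ZMod 3) : k = i ∨ k = i + 1 ∨ k = i + 2 := by revert i k; decide

section designs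

variable {W : Type*} [AddCommGroup W]

/-- blocks of type (i,i,i+1) -/
def baseA (S : HS W) (d : ZMod 3 → W) (a b c : ZMod 3 × W) : Prop :=
  a.1 = b.1 ∧ c.1 = a.1 + 1 ∧ a.2 ≠ b.2 ∧
    (S.psi c.2 = a.2 + b.2 + d a.1 ∨ S.psi c.2 = a.2 + b.2 + d a.1 + S.o)

/-- transversal blocks -/
def baseC (S : HS W) (d : ZMod 3 → W) (tag : Bool) (a b c : ZMod 3 × W) : Prop :=
  b.1 = a.1 + 1 ∧ c.1 = a.1 + 2 ∧ b.2 + b.2 = a.2 + a.2 + d a.1 ∧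
    c.2 + c.2 = b.2 + b.2 + d b.1 ∧ a.2 + a.2 = c.2 + c.2 + d c.1 ∧
    (S.p a.2 ^^ (S.p b.2 ^^ S.p c.2)) = tag

def EA (S : HS W) (d : ZMod 3 → W) (tag : Bool) : (a b c : ZMod 3 × W) → Prop :=
  sym3 fun a b c => baseA S d a b c ∨ baseC S d tag a b c

lemma EA_symR (S : HS W) (d : ZMod 3 → W) (tag : Bool) : SymR (EA S d tag) := by
  apply sym3_symR
  rintro ⟨i, x⟩ ⟨j, y⟩ ⟨k, z⟩ (⟨h1, h2, h3, -⟩ | ⟨h1, h2, -⟩)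
  · simp only at h1 h2 h3
    subst h1 h2
    simp [y01, h3]
  · simp only at h1 h2
    subst h1 h2
    simp only [ne_eq, Prod.mk.injEq, y01, y02, y12, false_and, not_false_eq_true, and_self]

lemma EA_same (S : HS W) (d : ZMod 3 → W) (tag : Bool) (i k : ZMod 3) (x y z : W) :
    EA S d tag (i, x) (i, y) (k, z) ↔ k = i + 1 ∧ x ≠ y ∧
      (S.psi z = x + y + d i ∨ S.psi z = x + y + d i + S.o) := by
  rcases lev3 i k with rfl | rfl | rfl <;>
  simp only [EA, sym3, baseA, baseC, z11, z12, z21, z22, y10, y20, y01, y02, y12, y21, false_and,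
    and_false, or_false, false_or, true_and, ne_comm (a := y) (b := x), add_comm y x, or_self]

lemma EA_next (S : HS W) (d : ZMod 3 → W) (tag : Bool) (i k : ZMod 3) (x y z : W) :
    EA S d tag (i, x) (i + 1, y) (k, z) ↔
      (k = i ∧ x ≠ z ∧ (S.psi y = x + z + d i ∨ S.psi y = x + z + d i + S.o)) ∨
      (k = i + 2 ∧ y + y = x + x + d i ∧ z + z = y + y + d (i + 1) ∧ x + x = z + z + d (i + 2) ∧
        (S.p x ^^ (S.p y ^^ S.p z)) = tag) := by
  rcases lev3 i k with rfl | rfl | rfl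
  · simp only [EA, sym3, baseA, baseC, z11, z12, z21, z22, y10, y20, y01, y02, y12, y21, false_and,
      and_false, or_false, false_or, true_and, ne_comm (a := z) (b := x), add_comm z x, or_self]
  · simp only [EA, sym3, baseA, baseC, z11, z12, z21, z22, y10, y20, y01, y02, y12, y21, false_and,
      and_false, or_false, false_or, true_and, or_self]
  · simp only [EA, sym3, baseA, baseC, z11, z12, z21, z22, y10, y20, y01, y02, y12, y21, false_and,
      and_false, or_false, false_or, true_and, or_self]
    have e1 : (S.p y ^^ (S.p z ^^ S.p x)) = (S.p x ^^ (S.p y ^^ S.p z)) := by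
      cases S.p x <;> cases S.p y <;> cases S.p z <;> rfl
    have e2 : (S.p z ^^ (S.p x ^^ S.p y)) = (S.p x ^^ (S.p y ^^ S.p z)) := by
      cases S.p x <;> cases S.p y <;> cases S.p z <;> rfl
    rw [e1, e2]
    tauto

lemma EA_count (S : HS W) (d t : ZMod 3 → W) (tag : Bool) (hd : ∀ i, d i = t i + t i)
    (hsum : ∀ i, d i + d (i + 1) + d (i + 2) = 0) (a b : ZMod 3 × W) (hab : a ≠ b) :
    {c | EA S d tag a b c}.ncard = 2 := by
  have next : ∀ (i : ZMod 3) (x y : W), {c | EA S d tag (i, x) (i + 1, y) c}.ncard = 2 := by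
    intro i x y
    by_cases hxy : y + y = x + x + d i
    · -- one of the two solutions is degenerate
      obtain ⟨z, hz, hpz⟩ := S.exists_p (y + t (i + 1)) (tag ^^ (S.p x ^^ S.p y))
      have hz2 : z + z = y + y + d (i + 1) := by rw [hz, hd]; abel
      have hz3 : x + x = z + z + d (i + 2) := by
        have := hsum i
        rw [hz2, hxy, show x + x + d i + d (i + 1) + d (i + 2) =
          x + x + (d i + d (i + 1) + d (i + 2)) by abel, this, add_zero]
      obtain ⟨x', hx'⟩ : ∃ x', x' = x + (if S.p y then S.o else - S.o) := ⟨_, rfl⟩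
      have hset : {c | EA S d tag (i, x) (i + 1, y) c} = {(i, x'), (i + 2, z)} := by
        ext ⟨k, u⟩
        simp only [Set.mem_setOf_eq, EA_next, Set.mem_insert_iff, Set.mem_singleton_iff,
          Prod.mk.injEq]
        have hA : (x ≠ u ∧ (S.psi y = x + u + d i ∨ S.psi y = x + u + d i + S.o)) ↔ u = x' := by
          rw [hx']
          unfold HS.psi
          rw [hxy]
          cases hpy : S.p y
          · simp only [Bool.false_eq_true, if_false, add_zero]
            constructor
            · rintro ⟨h1, h2 | h2⟩
              · exact absurd (by simpa [add_assoc] using h2) h1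
              · have : x + x + d i = x + (u + S.o) + d i := by rw [h2]; abel
                have := add_left_cancel (add_right_cancel this)
                rw [this]; abel
            · rintro rfl
              refine ⟨?_, Or.inr (by abel)⟩
              intro h
              exact S.o_ne_zero (by simpa using h)
          · simp only [if_true]
            constructor
            · rintro ⟨h1, h2 | h2⟩
              · have : x + (x + S.o) + d i = x + u + d i := by rw [← h2]; abel
                exact (add_left_cancel (add_right_cancel this)).symm
              · exact absurd (by simpa [add_assoc] using h2) h1
            · rintro rfl
              refine ⟨?_, Or.inl (by abel)⟩
              intro h
              exact S.o_ne_zero (by simpa using h)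
        have hC : (y + y = x + x + d i ∧ u + u = y + y + d (i + 1) ∧ x + x = u + u + d (i + 2) ∧
            (S.p x ^^ (S.p y ^^ S.p u)) = tag) ↔ u = z := by
          constructor
          · rintro ⟨-, h2, -, h4⟩
            apply S.eq_of_p (by rw [h2, hz2])
            rw [hpz, ← h4]
            cases S.p x <;> cases S.p y <;> cases S.p u <;> rfl
          · rintro rfl
            refine ⟨hxy, hz2, hz3, ?_⟩
            rw [hpz]
            cases S.p x <;> cases S.p y <;> cases tag <;> rfl
        rw [hA, hC]
      rw [hset]
      apply Set.ncard_pair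
      simp only [ne_eq, Prod.mk.injEq, y02, false_and, not_false_eq_true]
    · have hset : {c | EA S d tag (i, x) (i + 1, y) c} =
          {(i, S.psi y - x - d i), (i, S.psi y - x - d i - S.o)} := by
        ext ⟨k, u⟩
        simp only [Set.mem_setOf_eq, EA_next, Set.mem_insert_iff, Set.mem_singleton_iff,
          Prod.mk.injEq, hxy, false_and, and_false, or_false]
        have h1 : S.psi y = x + u + d i ↔ u = S.psi y - x - d i := by
          constructor
          · intro h; rw [h]; abel
          · rintro rfl; abel
        have h2 : S.psi y = x + u + d i + S.o ↔ u = S.psi y - x - d i - S.o := by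
          constructor
          · intro h; rw [h]; abel
          · intro h; rw [h]; abel
        have h3 : (S.psi y = x + u + d i ∨ S.psi y = x + u + d i + S.o) → x ≠ u := by
          rintro h rfl
          unfold HS.psi at h
          have o1 := S.o_ne y (x + t i)
          have o2 := S.o_ne (x + t i) y
          have e3 : x + t i + (x + t i) = x + x + d i := by rw [hd]; abel
          rw [e3] at o1 o2
          cases hpy : S.p y <;> simp [hpy] at h
          · rcases h with h | h
            · exact hxy h
            · exact o1 h
          · rcases h with h | h
            · exact o2 h.symm
            · exact hxy h
        rw [← h1, ← h2]
        tauto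
      rw [hset]
      apply Set.ncard_pair
      intro h
      have := (Prod.mk.inj h).2
      exact S.o_ne_zero (sub_eq_self.1 this.symm)
  obtain ⟨i, x⟩ := a
  obtain ⟨j, y⟩ := b
  rcases lev3 i j with rfl | rfl | rfl
  · have hxy : x ≠ y := fun h => hab (by rw [h])
    obtain ⟨z1, h1⟩ := S.psi_surj (x + y + d j)
    obtain ⟨z2, h2⟩ := S.psi_surj (x + y + d j + S.o)
    have hset : {c | EA S d tag (j, x) (j, y) c} = {(j + 1, z1), (j + 1, z2)} := by
      ext ⟨k, u⟩
      simp only [Set.mem_setOf_eq, EA_same, Set.mem_insert_iff, Set.mem_singleton_iff,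
          Prod.mk.injEq]
      rw [← h2, ← h1]
      have e1 : S.psi u = S.psi z1 ↔ u = z1 := ⟨fun h => S.psi_inj h, fun h => by rw [h]⟩
      have e2 : S.psi u = S.psi z2 ↔ u = z2 := ⟨fun h => S.psi_inj h, fun h => by rw [h]⟩
      rw [e1, e2]
      tauto
    rw [hset]
    apply Set.ncard_pair
    intro h
    have h3 := (Prod.mk.inj h).2
    rw [h3, h2] at h1
    exact S.o_ne_zero (by simpa using h1)
  · exact next i x y
  · have := next (i + 2) y x
    rw [z21] at this
    rw [← this]
    congr 1
    ext c
    exact ⟨(EA_symR S d tag).s1 _ _ _, (EA_symR S d tag).s1 _ _ _⟩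

end designs


/-! ### Part 4: mirrored designs, the one-fold part, and disjointness -/

section designs2

variable {W : Type*} [AddCommGroup W]

lemma sym3_disj {P : Type*} {R Q : P → P → P → Prop} (hQ : SymR Q)
    (h : ∀ a b c, R a b c → ¬ Q a b c) (a b c : P) (hs : sym3 R a b c) : ¬ Q a b c := by
  have s1 := hQ.s1
  have s2 := hQ.s2
  intro hq
  rcases hs with hs | hs | hs | hs | hs | hs
  · exact h _ _ _ hs hq
  · exact h _ _ _ hs (s2 _ _ _ hq)
  · exact h _ _ _ hs (s1 _ _ _ hq)
  · exact h _ _ _ hs (s2 _ _ _ (s1 _ _ _ hq))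
  · exact h _ _ _ hs (s1 _ _ _ (s2 _ _ _ hq))
  · exact h _ _ _ hs (s2 _ _ _ (s1 _ _ _ (s2 _ _ _ hq)))

/-- The mirror map on points. -/
def nm (a : ZMod 3 × W) : ZMod 3 × W := (-a.1, a.2)

lemma nm_nm (a : ZMod 3 × W) : nm (nm a) = a := by simp [nm]

lemma nm_inj {a b : ZMod 3 × W} (h : nm a = nm b) : a = b := by
  rw [← nm_nm a, h, nm_nm]

/-- The mirrored design. -/
def EB (S : HS W) (d : ZMod 3 → W) (a b c : ZMod 3 × W) : Prop :=
  EA S d true (nm a) (nm b) (nm c)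

lemma EB_symR (S : HS W) (d : ZMod 3 → W) : SymR (EB S d) := by
  have h := EA_symR S d true
  constructor
  · intro a b c; exact h.s1 _ _ _
  · intro a b c; exact h.s2 _ _ _
  · intro a b c hs hab
    exact h.ne _ _ _ hs (by rw [hab])

lemma EB_count (S : HS W) (d t : ZMod 3 → W) (hd : ∀ i, d i = t i + t i)
    (hsum : ∀ i, d i + d (i + 1) + d (i + 2) = 0) (a b : ZMod 3 × W) (hab : a ≠ b) :
    {c | EB S d a b c}.ncard = 2 := by
  rw [← EA_count S d t true hd hsum (nm a) (nm b) (fun h => hab (nm_inj h))]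
  have : {c | EA S d true (nm a) (nm b) c} = nm '' {c | EB S d a b c} := by
    ext c
    simp only [Set.mem_image, EB]
    constructor
    · intro h
      exact ⟨nm c, by simpa [nm_nm] using h, nm_nm c⟩
    · rintro ⟨x, hx, rfl⟩
      exact hx
  rw [this, Set.ncard_image_of_injective _ (fun a b h => nm_inj h)]

lemma two_d (S : HS W) (d d' t t' : W) (hd : d = t + t) (hd' : d' = t' + t') (u x : W)
    (h : u = x + d ∨ u = x + d + S.o) (h' : u = x + d' ∨ u = x + d' + S.o) : d = d' := by
  rcases h with h | h <;> rcases h' with h' | h'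
  · rw [h] at h'; exact add_left_cancel h'
  · rw [h, add_assoc, hd, hd'] at h'
    exact absurd (add_left_cancel h') (S.o_ne _ _)
  · rw [h, add_assoc, hd, hd'] at h'
    exact absurd (add_left_cancel h').symm (S.o_ne _ _)
  · rw [h] at h'; exact add_left_cancel (add_right_cancel h')

lemma EA_disj (S : HS W) (d t d' t' : ZMod 3 → W) (tag : Bool) (hd : ∀ i, d i = t i + t i)
    (hd' : ∀ i, d' i = t' i + t' i) (hne : ∀ i, d i ≠ d' i) (a b c : ZMod 3 × W)
    (h : EA S d tag a b c) : ¬ EA S d' tag a b c := by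
  refine sym3_disj (EA_symR S d' tag) ?_ a b c h
  rintro ⟨i, x⟩ ⟨j, y⟩ ⟨k, z⟩ (⟨h1, h2, h3, h4⟩ | ⟨h1, h2, h3, h4, h5, h6⟩)
  · simp only at h1 h2 h3 h4
    subst h1 h2
    rw [EA_same]
    rintro ⟨-, -, h5⟩
    exact hne i (two_d S _ _ _ _ (hd i) (hd' i) _ _ h4 h5)
  · simp only at h1 h2 h3 h4 h5 h6
    subst h1 h2
    rw [EA_next]
    rintro (⟨h7, -⟩ | ⟨-, h7, -⟩)
    · exact (y20 i).1 h7
    · rw [h3] at h7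
      exact hne i (add_left_cancel h7)

lemma EB_disj (S : HS W) (d t d' t' : ZMod 3 → W) (hd : ∀ i, d i = t i + t i)
    (hd' : ∀ i, d' i = t' i + t' i) (hne : ∀ i, d i ≠ d' i) (a b c : ZMod 3 × W)
    (h : EB S d a b c) : ¬ EB S d' a b c :=
  EA_disj S d t d' t' true hd hd' hne _ _ _ h

lemma n1 (i : ZMod 3) : (-(i + 1) = -i + 1) ↔ False := by revert i; decide
lemma n2 (i : ZMod 3) : -i = -(i + 1) + 1 := by revert i; decide
lemma n3 (i : ZMod 3) : (-(i + 2) = -(i + 1)) ↔ False := by revert i; decide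
lemma n4 (i : ZMod 3) : -(i + 1) + 1 = -i := by revert i; decide
lemma n5 (i : ZMod 3) : -(i + 1) + 2 = -(i + 2) := by revert i; decide
lemma n6 (i : ZMod 3) : -(i + 1) + 1 = -i := by revert i; decide

lemma EB_same_up (S : HS W) (d : ZMod 3 → W) (i : ZMod 3) (x y z : W) :
    ¬ EB S d (i, x) (i, y) (i + 1, z) := by
  unfold EB nm
  simp only
  rw [EA_same, n1]
  simp

lemma EB_trans (S : HS W) (d : ZMod 3 → W) (i : ZMod 3) (x y z : W)
    (h : EB S d (i, x) (i + 1, y) (i + 2, z)) :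
    (∃ j, x + x = y + y + d j ∧ z + z = x + x + d (j + 1) ∧ y + y = z + z + d (j + 2)) ∧
      (S.p x ^^ (S.p y ^^ S.p z)) = true := by
  have h := (EB_symR S d).s1 _ _ _ h
  unfold EB nm at h
  simp only at h
  rw [n2 i, EA_next] at h
  rcases h with ⟨h1, -⟩ | ⟨-, h2, h3, h4, h5⟩
  · exact absurd h1 (by rw [n3]; simp)
  · refine ⟨⟨_, h2, h3, h4⟩, ?_⟩
    rw [← h5]
    cases S.p x <;> cases S.p y <;> cases S.p z <;> rfl

lemma EA_EB_disj (S : HS W) (d d' : ZMod 3 → W) (a b c : ZMod 3 × W)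
    (h : EA S d false a b c) : ¬ EB S d' a b c := by
  refine sym3_disj (EB_symR S d') ?_ a b c h
  rintro ⟨i, x⟩ ⟨j, y⟩ ⟨k, z⟩ (⟨h1, h2, h3, h4⟩ | ⟨h1, h2, h3, h4, h5, h6⟩)
  · simp only at h1 h2 h3 h4
    subst h1 h2
    exact EB_same_up _ _ _ _ _ _
  · simp only at h1 h2 h3 h4 h5 h6
    subst h1 h2
    intro h
    have := (EB_trans _ _ _ _ _ _ h).2
    rw [h6] at this
    simp at this

/-- which hole blocks are used -/
def Qh (s : Fin 3) (i : ZMod 3) (a b c : Bool) : Bool :=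
  if s = 0 then !a && !b && !c
  else if s = 1 then (a && !b && !c) || (!a && b && !c) || (!a && !b && c)
  else (!a || i = 0) && (!b || i + 1 = 0) && (!c || i + 2 = 0)

lemma Qh_rot (s : Fin 3) (i : ZMod 3) (a b c : Bool) : Qh s (i + 1) b c a = Qh s i a b c := by
  revert s i a b c; decide

lemma Qh_rot2 (s : Fin 3) (i : ZMod 3) (a b c : Bool) : Qh s (i + 2) c a b = Qh s i a b c := by
  revert s i a b c; decide

/-- defect +1 -/
def c1 (s : Fin 3) (i : ZMod 3) (a b : Bool) : Bool :=
  (s = 1 && !a && b) || (s = 2 && ((i = 1 && !a && !b) || (i = 2 && !a && b)))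

/-- defect -1 -/
def cm (s : Fin 3) (i : ZMod 3) (a b : Bool) : Bool :=
  a && !b && (s = 0 || (s = 2 && i ≠ 0))

lemma count_c (s : Fin 3) (i : ZMod 3) (a b : Bool) :
    ((if b = true then 1 else 0 : ℤ) + (if Qh s i a b false = true then 1 else 0) +
      (if Qh s i a b true = true then 1 else 0)) =
      1 + (if c1 s i a b = true then 1 else 0) - (if cm s i a b = true then 1 else 0) := by
  revert s i a b; decide

lemma c1_cm (s : Fin 3) (i : ZMod 3) (a b : Bool) (h1 : c1 s i a b = true) :
    ¬ cm s i a b = true := by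
  revert s i a b; decide

def baseN (S : HS W) (a b c : ZMod 3 × W) : Prop :=
  a.1 = b.1 ∧ c.1 = a.1 + 1 ∧ a.2 ≠ b.2 ∧ S.psi c.2 = a.2 + b.2

def baseH (S : HS W) (st : W → Fin 3) (a b c : ZMod 3 × W) : Prop :=
  b.1 = a.1 + 1 ∧ c.1 = a.1 + 2 ∧ a.2 + a.2 = b.2 + b.2 ∧ a.2 + a.2 = c.2 + c.2 ∧
    Qh (st a.2) a.1 (S.p a.2) (S.p b.2) (S.p c.2) = true

/-- the one-fold part -/
def NR (S : HS W) (st : W → Fin 3) : (a b c : ZMod 3 × W) → Prop :=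
  sym3 fun a b c => baseN S a b c ∨ baseH S st a b c

lemma NR_symR (S : HS W) (st : W → Fin 3) : SymR (NR S st) := by
  apply sym3_symR
  rintro ⟨i, x⟩ ⟨j, y⟩ ⟨k, z⟩ (⟨h1, h2, h3, -⟩ | ⟨h1, h2, -⟩)
  · simp only at h1 h2 h3
    subst h1 h2
    simp [h3]
  · simp only at h1 h2
    subst h1 h2
    simp only [ne_eq, Prod.mk.injEq, y01, y02, y12, false_and, not_false_eq_true, and_self]

lemma NR_same (S : HS W) (st : W → Fin 3) (i k : ZMod 3) (x y z : W) :
    NR S st (i, x) (i, y) (k, z) ↔ k = i + 1 ∧ x ≠ y ∧ S.psi z = x + y := by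
  rcases lev3 i k with rfl | rfl | rfl <;>
  simp only [NR, sym3, baseN, baseH, z11, z12, z21, z22, y10, y20, y01, y02, y12, y21, false_and,
    and_false, or_false, false_or, true_and, ne_comm (a := y) (b := x), add_comm y x, or_self]

lemma NR_next (S : HS W) (st : W → Fin 3) (hst : ∀ x, st (x + S.w) = st x)
    (i k : ZMod 3) (x y z : W) :
    NR S st (i, x) (i + 1, y) (k, z) ↔
      (k = i ∧ x ≠ z ∧ S.psi y = x + z) ∨
      (k = i + 2 ∧ x + x = y + y ∧ x + x = z + z ∧
        Qh (st x) i (S.p x) (S.p y) (S.p z) = true) := by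
  have hs : ∀ x y, x + x = y + y → st y = st x := by
    intro x y h
    rcases S.ker2 h with rfl | rfl
    · rfl
    · exact hst x
  rcases lev3 i k with rfl | rfl | rfl
  · simp only [NR, sym3, baseN, baseH, z11, z12, z21, z22, y10, y20, y01, y02, y12, y21, false_and,
      and_false, or_false, false_or, true_and, ne_comm (a := z) (b := x), add_comm z x, or_self]
  · simp only [NR, sym3, baseN, baseH, z11, z12, z21, z22, y10, y20, y01, y02, y12, y21, false_and,
      and_false, or_false, false_or, true_and, or_self]
  · simp only [NR, sym3, baseN, baseH, z11, z12, z21, z22, y10, y20, y01, y02, y12, y21, false_and,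
      and_false, or_false, false_or, true_and, or_self]
    constructor
    · rintro (h | ⟨h1, h2, h3⟩ | ⟨h1, h2, h3⟩)
      · exact h
      · refine ⟨h2.symm, h2.symm.trans h1, ?_⟩
        rw [hs _ _ h2.symm, Qh_rot] at h3
        exact h3
      · refine ⟨h1.symm.trans h2, h1.symm, ?_⟩
        rw [hs _ _ h1.symm, Qh_rot2] at h3
        exact h3
    · exact Or.inl

lemma ncard3 {P : Type*} (a b c : P) (hab : a ≠ b) (hac : a ≠ c) (hbc : b ≠ c) (p q r : Prop)
    [Decidable p] [Decidable q] [Decidable r] :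
    (({x | (x = a ∧ p) ∨ (x = b ∧ q) ∨ (x = c ∧ r)} : Set P).ncard : ℤ) =
      (if p then 1 else 0) + (if q then 1 else 0) + (if r then 1 else 0) := by
  classical
  have : ({x | (x = a ∧ p) ∨ (x = b ∧ q) ∨ (x = c ∧ r)} : Set P) =
      ((if p then {a} else ∅ : Finset P) ∪ ((if q then {b} else ∅) ∪ (if r then {c} else ∅))
        : Finset P) := by
    ext x
    by_cases hp : p <;> by_cases hq : q <;> by_cases hr : r <;>
      (simp [hp, hq, hr]; try tauto)
  rw [this, Set.ncard_coe_finset]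
  by_cases hp : p <;> by_cases hq : q <;> by_cases hr : r <;>
    simp [hp, hq, hr, hab, hab.symm, hac, hbc, card_insert_of_notMem, ← Finset.insert_eq]

/-- Defect relation. -/
def eR (S : HS W) (st : W → Fin 3) (f : Fin 3 → ZMod 3 → Bool → Bool → Bool)
    (a b : ZMod 3 × W) : Prop :=
  b.1 = a.1 + 1 ∧ a.2 + a.2 = b.2 + b.2 ∧ f (st a.2) a.1 (S.p a.2) (S.p b.2) = true

open scoped Classical in
lemma NR_count (S : HS W) (st : W → Fin 3) (hst : ∀ x, st (x + S.w) = st x)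
    (a b : ZMod 3 × W) (hab : a ≠ b) :
    ({c | NR S st a b c}.ncard : ℤ) = 1 + (if eR S st c1 a b ∨ eR S st c1 b a then 1 else 0)
      - (if eR S st cm a b ∨ eR S st cm b a then 1 else 0) := by
  have next : ∀ (i : ZMod 3) (x y : W), ({c | NR S st (i, x) (i + 1, y) c}.ncard : ℤ) =
      1 + (if eR S st c1 (i, x) (i + 1, y) ∨ eR S st c1 (i + 1, y) (i, x) then 1 else 0)
      - (if eR S st cm (i, x) (i + 1, y) ∨ eR S st cm (i + 1, y) (i, x) then 1 else 0) := by
    intro i x y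
    simp only [eR, z11, y02, false_and, or_false, true_and]
    by_cases hxy : x + x = y + y
    · simp only [hxy, true_and]
      rw [← count_c]
      obtain ⟨zf, hf, hpf⟩ := S.exists_p x false
      obtain ⟨zt, ht, hpt⟩ := S.exists_p x true
      have hne : zf ≠ zt := by
        rintro rfl
        rw [hpf] at hpt
        simp at hpt
      rw [← ncard3 ((i, x + S.o) : ZMod 3 × W) (i + 2, zf) (i + 2, zt) 
        (by simp only [ne_eq, Prod.mk.injEq, y02, false_and, not_false_eq_true])
        (by simp only [ne_eq, Prod.mk.injEq, y02, false_and, not_false_eq_true]) (by simpa using hne)]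
      congr 2
      ext ⟨k, u⟩
      simp only [Set.mem_setOf_eq, NR_next S st hst, Prod.mk.injEq, hxy, true_and]
      have hA : (x ≠ u ∧ S.psi y = x + u) ↔ (u = x + S.o ∧ S.p y = true) := by
        unfold HS.psi
        rw [← hxy]
        cases hpy : S.p y
        · simp
        · simp only [if_true, and_true]
          constructor
          · rintro ⟨-, h⟩
            rw [add_assoc] at h
            exact (add_left_cancel h).symm
          · rintro rfl
            refine ⟨?_, by abel⟩
            intro h
            exact S.o_ne_zero (by simpa using h)
      have hB : (y + y = u + u ∧ Qh (st x) i (S.p x) (S.p y) (S.p u) = true) ↔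
          ((u = zf ∧ Qh (st x) i (S.p x) (S.p y) false = true) ∨
            (u = zt ∧ Qh (st x) i (S.p x) (S.p y) true = true)) := by
        constructor
        · rintro ⟨h1, h2⟩
          cases hu : S.p u
          · left
            refine ⟨S.eq_of_p (by rw [hf, hxy, h1]) (by rw [hu, hpf]), by rwa [hu] at h2⟩
          · right
            refine ⟨S.eq_of_p (by rw [ht, hxy, h1]) (by rw [hu, hpt]), by rwa [hu] at h2⟩
        · rintro (⟨rfl, h⟩ | ⟨rfl, h⟩)
          · exact ⟨by rw [hf, hxy], by rwa [hpf]⟩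
          · exact ⟨by rw [ht, hxy], by rwa [hpt]⟩
      rw [hA, hB]
      constructor
      · rintro (⟨h1, h2, h3⟩ | ⟨h1, ⟨h2, h3⟩ | ⟨h2, h3⟩⟩)
        · exact Or.inl ⟨⟨h1, h2⟩, h3⟩
        · exact Or.inr (Or.inl ⟨⟨h1, h2⟩, h3⟩)
        · exact Or.inr (Or.inr ⟨⟨h1, h2⟩, h3⟩)
      · rintro (⟨⟨h1, h2⟩, h3⟩ | ⟨⟨h1, h2⟩, h3⟩ | ⟨⟨h1, h2⟩, h3⟩)
        · exact Or.inl ⟨h1, h2, h3⟩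
        · exact Or.inr ⟨h1, Or.inl ⟨h2, h3⟩⟩
        · exact Or.inr ⟨h1, Or.inr ⟨h2, h3⟩⟩
    · simp only [hxy, false_and, if_false]
      have : {c | NR S st (i, x) (i + 1, y) c} = {(i, S.psi y - x)} := by
        ext ⟨k, u⟩
        simp only [Set.mem_setOf_eq, NR_next S st hst, Prod.mk.injEq, hxy, false_and, and_false,
          or_false, Set.mem_singleton_iff]
        have h1 : S.psi y = x + u ↔ u = S.psi y - x := by
          constructor
          · intro h; rw [h]; abel
          · rintro rfl; abel
        have h2 : S.psi y = x + u → x ≠ u := by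
          rintro h rfl
          unfold HS.psi at h
          cases hpy : S.p y <;> simp [hpy] at h
          · exact hxy h.symm
          · exact S.o_ne _ _ h.symm
        rw [← h1]
        exact ⟨fun h => ⟨h.1, h.2.2⟩, fun h => ⟨h.1, h2 h.2, h.2⟩⟩
      rw [this, Set.ncard_singleton]
      simp
  obtain ⟨i, x⟩ := a
  obtain ⟨j, y⟩ := b
  rcases lev3 i j with rfl | rfl | rfl
  · have hxy : x ≠ y := fun h => hab (by rw [h])
    obtain ⟨z1, h1⟩ := S.psi_surj (x + y)
    have hset : {c | NR S st (j, x) (j, y) c} = {(j + 1, z1)} := by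
      ext ⟨k, u⟩
      simp only [Set.mem_setOf_eq, NR_same, Set.mem_singleton_iff,
          Prod.mk.injEq]
      rw [← h1]
      have e1 : S.psi u = S.psi z1 ↔ u = z1 := ⟨fun h => S.psi_inj h, fun h => by rw [h]⟩
      rw [e1]
      tauto
    rw [hset, Set.ncard_singleton]
    simp [eR, y01]
  · exact next i x y
  · have := next (i + 2) y x
    rw [z21] at this
    have hset : {c | NR S st (i, x) (i + 2, y) c} = {c | NR S st (i + 2, y) (i, x) c} := by
      ext c
      exact ⟨(NR_symR S st).s1 _ _ _, (NR_symR S st).s1 _ _ _⟩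
    rw [hset, this]
    simp only [or_comm]

lemma NR_EA_disj (S : HS W) (st : W → Fin 3) (d t : ZMod 3 → W)
    (hd : ∀ i, d i = t i + t i) (hne : ∀ i, d i ≠ 0) (tag : Bool) (a b c : ZMod 3 × W)
    (h : NR S st a b c) : ¬ EA S d tag a b c := by
  refine sym3_disj (EA_symR S d tag) ?_ a b c h
  rintro ⟨i, x⟩ ⟨j, y⟩ ⟨k, z⟩ (⟨h1, h2, h3, h4⟩ | ⟨h1, h2, h3, h4, h5⟩)
  · simp only at h1 h2 h3 h4
    subst h1 h2
    rw [EA_same]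
    rintro ⟨-, -, h5⟩
    exact hne i (two_d S (d i) 0 (t i) 0 (hd i) (by simp) _ _ h5 (by simp [h4]))
  · simp only at h1 h2 h3 h4 h5
    subst h1 h2
    rw [EA_next]
    rintro (⟨h7, -⟩ | ⟨-, h7, -⟩)
    · exact (y20 i).1 h7
    · rw [← h3] at h7
      exact hne i (by simpa using h7)

lemma NR_EB_disj (S : HS W) (st : W → Fin 3) (d : ZMod 3 → W)
    (i0 : ZMod 3) (hne : d i0 ≠ 0) (a b c : ZMod 3 × W)
    (h : NR S st a b c) : ¬ EB S d a b c := by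
  refine sym3_disj (EB_symR S d) ?_ a b c h
  rintro ⟨i, x⟩ ⟨j, y⟩ ⟨k, z⟩ (⟨h1, h2, h3, h4⟩ | ⟨h1, h2, h3, h4, h5⟩)
  · simp only at h1 h2 h3 h4
    subst h1 h2
    exact EB_same_up _ _ _ _ _ _
  · simp only at h1 h2 h3 h4 h5
    subst h1 h2
    intro h
    obtain ⟨⟨j, g1, g2, g3⟩, -⟩ := EB_trans _ _ _ _ _ _ h
    apply hne
    rw [← h3] at g1 g3
    rw [← h4] at g2 g3
    rcases lev3 j i0 with rfl | rfl | rfl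
    · simpa using g1
    · simpa using g2
    · simpa using g3

end designs2

/-! ### Part 5: the shape of the defect graph -/

section shape

open scoped Classical in
/-- The set of pairs given by a relation. -/
noncomputable def prs {P : Type*} [Fintype α] (q : P ≃ α) (r : P → P → Prop) :
    Finset (Finset α) :=
  univ.filter fun T => ∃ a b, r a b ∧ T = {q a, q b}

lemma mem_prs {P : Type*} [Fintype α] (q : P ≃ α) (r : P → P → Prop) (T : Finset α) :
    T ∈ prs q r ↔ ∃ a b, r a b ∧ T = {q a, q b} := by
  simp [prs]

lemma pair_q {P : Type*} (q : P ≃ α) (a b c d : P)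
    (h : ({q a, q b} : Finset α) = {q c, q d}) : (a = c ∧ b = d) ∨ (a = d ∧ b = c) := by
  have ha : q a ∈ ({q c, q d} : Finset α) := by rw [← h]; simp
  have hb : q b ∈ ({q c, q d} : Finset α) := by rw [← h]; simp
  have hc : q c ∈ ({q a, q b} : Finset α) := by rw [h]; simp
  have hd : q d ∈ ({q a, q b} : Finset α) := by rw [h]; simp
  simp only [mem_insert, mem_singleton, EmbeddingLike.apply_eq_iff_eq] at ha hb hc hd
  rcases ha with rfl | rfl <;> rcases hb with rfl | rfl <;> simp_all

lemma mem_prs_pair {P : Type*} [Fintype α] (q : P ≃ α) (r : P → P → Prop) (a b : P) :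
    ({q a, q b} : Finset α) ∈ prs q r ↔ r a b ∨ r b a := by
  rw [mem_prs]
  constructor
  · rintro ⟨c, d, h, e⟩
    rcases pair_q q _ _ _ _ e with ⟨rfl, rfl⟩ | ⟨rfl, rfl⟩
    · exact Or.inl h
    · exact Or.inr h
  · rintro (h | h)
    · exact ⟨a, b, h, rfl⟩
    · exact ⟨b, a, h, pair_comm _ _⟩

lemma pm {P : Type*} [Fintype α] (q : P ≃ α) (X : Finset α) (r : P → P → Prop)
    (hirr : ∀ a b, r a b → a ≠ b) (hX : ∀ a b, r a b → q a ∈ X ∧ q b ∈ X)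
    (hex : ∀ a, q a ∈ X → ∃ b, r a b ∨ r b a)
    (hu : ∀ a b c, (r a b ∨ r b a) → (r a c ∨ r c a) → b = c) :
    IsPerfectMatchingOn X (prs q r) := by
  constructor
  · intro p hp
    obtain ⟨a, b, h, rfl⟩ := (mem_prs _ _ _).1 hp
    refine ⟨card_pair (by simpa using hirr a b h), ?_⟩
    intro x hx
    simp only [mem_insert, mem_singleton] at hx
    rcases hx with rfl | rfl
    · exact (hX _ _ h).1
    · exact (hX _ _ h).2
  · intro x hx
    obtain ⟨a, rfl⟩ := q.surjective x
    obtain ⟨b, hb⟩ := hex a hx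
    refine ⟨{q a, q b}, ⟨(mem_prs_pair _ _ _ _).2 hb, by simp⟩, ?_⟩
    rintro T ⟨hT, haT⟩
    obtain ⟨c, d, h, rfl⟩ := (mem_prs _ _ _).1 hT
    simp only [mem_insert, mem_singleton, EmbeddingLike.apply_eq_iff_eq] at haT
    rcases haT with rfl | rfl
    · rw [hu _ _ _ hb (Or.inl h)]
    · rw [hu _ _ _ hb (Or.inr h), pair_comm]

variable {W : Type*} [AddCommGroup W] [Fintype α]

lemma eR_asymm (S : HS W) (st : W → Fin 3) (f g) (a b : ZMod 3 × W) (h : eR S st f a b) :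
    ¬ eR S st g b a := by
  intro h'
  have h1 := h.1
  rw [h'.1, z11] at h1
  exact (y02 _).1 h1

lemma prs_union (S : HS W) (st : W → Fin 3) (q : ZMod 3 × W ≃ α) (f g) :
    prs q (eR S st f) ∪ prs q (eR S st g) =
      prs q (eR S st fun s i a b => f s i a b || g s i a b) := by
  ext T
  simp only [mem_union, mem_prs, eR, Bool.or_eq_true]
  constructor
  · rintro (⟨a, b, ⟨h1, h2, h3⟩, h4⟩ | ⟨a, b, ⟨h1, h2, h3⟩, h4⟩)
    · exact ⟨a, b, ⟨h1, h2, Or.inl h3⟩, h4⟩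
    · exact ⟨a, b, ⟨h1, h2, Or.inr h3⟩, h4⟩
  · rintro ⟨a, b, ⟨h1, h2, h3 | h3⟩, h4⟩
    · exact Or.inl ⟨a, b, ⟨h1, h2, h3⟩, h4⟩
    · exact Or.inr ⟨a, b, ⟨h1, h2, h3⟩, h4⟩

lemma prs_sdiff (S : HS W) (st : W → Fin 3) (q : ZMod 3 × W ≃ α) (f g) :
    prs q (eR S st f) \ prs q (eR S st g) =
      prs q (eR S st fun s i a b => f s i a b && !g s i a b) := by
  ext T
  rw [mem_sdiff]
  constructor
  · rintro ⟨h0, h'⟩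
    obtain ⟨a, b, h, rfl⟩ := (mem_prs _ _ _).1 h0
    rw [mem_prs_pair] at h' ⊢
    left
    refine ⟨h.1, h.2.1, ?_⟩
    simp only [Bool.and_eq_true, Bool.not_eq_true', h.2.2, true_and]
    by_contra hc
    exact h' (Or.inl ⟨h.1, h.2.1, by simpa using hc⟩)
  · intro h0
    obtain ⟨a, b, h, rfl⟩ := (mem_prs _ _ _).1 h0
    have h3 := h.2.2
    simp only [Bool.and_eq_true, Bool.not_eq_true'] at h3
    rw [mem_prs_pair, mem_prs_pair]
    refine ⟨Or.inl ⟨h.1, h.2.1, h3.1⟩, ?_⟩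
    rintro (h' | h')
    · rw [h'.2.2] at h3
      simp at h3
    · exact eR_asymm S st _ _ _ _ h h'

/-- relations with different values of `p` -/
lemma eR_iff (S : HS W) (st : W → Fin 3) (f) (hf : ∀ s i a, f s i a a = false)
    (a b : ZMod 3 × W) :
    eR S st f a b ↔ b = (a.1 + 1, a.2 + S.w) ∧ f (st a.2) a.1 (S.p a.2) (!S.p a.2) = true := by
  obtain ⟨i, x⟩ := a
  obtain ⟨j, y⟩ := b
  simp only [eR, Prod.mk.injEq]
  constructor
  · rintro ⟨h1, h2, h3⟩
    rcases S.ker2 h2 with rfl | rfl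
    · rw [hf] at h3; simp at h3
    · rw [S.hp] at h3
      exact ⟨⟨h1, rfl⟩, h3⟩
  · rintro ⟨⟨rfl, rfl⟩, h3⟩
    exact ⟨rfl, (S.dbl_w x).symm, by rwa [S.hp]⟩

open scoped Classical in
lemma card_prs [Fintype W] (S : HS W) (st : W → Fin 3) (q : ZMod 3 × W ≃ α) (f)
    (hf : ∀ s i a, f s i a a = false) :
    (prs q (eR S st f)).card = (univ.filter fun a : ZMod 3 × W =>
      f (st a.2) a.1 (S.p a.2) (!S.p a.2) = true).card := by
  symm
  apply card_bij (fun a _ => ({q a, q (a.1 + 1, a.2 + S.w)} : Finset α))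
  · intro a ha
    rw [mem_filter] at ha
    rw [mem_prs_pair]
    left
    rw [eR_iff S st f hf]
    exact ⟨rfl, ha.2⟩
  · rintro ⟨i, x⟩ ha ⟨j, y⟩ hb h
    rcases pair_q q _ _ _ _ h with h | h
    · exact h.1
    · simp only [Prod.mk.injEq] at h
      have h1 := h.1.1
      rw [← h.2.1, z11] at h1
      exact absurd h1 (by rw [y02]; simp)
  · intro T hT
    obtain ⟨a, b, h, rfl⟩ := (mem_prs _ _ _).1 hT
    rw [eR_iff S st f hf] at h
    exact ⟨a, by simp [h.2], by rw [h.1]⟩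

/-- star edges -/
def cs (s : Fin 3) (i : ZMod 3) (a b : Bool) : Bool :=
  s = 2 && ((i = 1 && !b) || (i = 2 && !a && b))

def c1' (s : Fin 3) (_ : ZMod 3) (a b : Bool) : Bool := s = 1 && !a && b

def cm' (s : Fin 3) (i : ZMod 3) (a b : Bool) : Bool := a && !b && (s = 0 || (s = 2 && i = 2))

def cc (s : Fin 3) (i : ZMod 3) (a b : Bool) : Bool := c1' s i a b || cm' s i a b

lemma c1_sd (s : Fin 3) (i : ZMod 3) (a b : Bool) : (c1 s i a b && !cs s i a b) = c1' s i a b := by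
  revert s i a b; decide

lemma cm_sd (s : Fin 3) (i : ZMod 3) (a b : Bool) : (cm s i a b && !cs s i a b) = cm' s i a b := by
  revert s i a b; decide

lemma cc_sd (s : Fin 3) (i : ZMod 3) (a b : Bool) :
    ((c1 s i a b || cm s i a b) && !cs s i a b) = cc s i a b := by
  revert s i a b; decide

lemma c1'_self (s : Fin 3) (i : ZMod 3) (a : Bool) : c1' s i a a = false := by
  revert s i a; decide

lemma cm'_self (s : Fin 3) (i : ZMod 3) (a : Bool) : cm' s i a a = false := by
  revert s i a; decide

lemma cc_self (s : Fin 3) (i : ZMod 3) (a : Bool) : cc s i a a = false := by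
  revert s i a; decide

/-- points not in the star -/
def xc (s : Fin 3) (i : ZMod 3) (a : Bool) : Bool := s ≠ 2 || (i = 2 && a) || (i = 0 && !a)

lemma cc_x (s : Fin 3) (i : ZMod 3) (a : Bool) (h : cc s i a (!a) = true) :
    xc s i a = true ∧ xc s (i + 1) (!a) = true := by
  revert s i a; decide

lemma cc_ex (s : Fin 3) (i : ZMod 3) (a : Bool) (h : xc s i a = true) :
    cc s i a (!a) = true ∨ cc s (i + 2) (!a) a = true := by
  revert s i a; decide

lemma cc_un (s : Fin 3) (i : ZMod 3) (a : Bool) (h : cc s i a (!a) = true)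
    (h' : cc s (i + 2) (!a) a = true) : False := by
  revert s i a; decide

lemma w_w (S : HS W) (x : W) : x + S.w + S.w = x := by
  rw [add_assoc, S.hww, add_zero]

lemma pm_main (S : HS W) (st : W → Fin 3) (hst : ∀ x, st (x + S.w) = st x)
    (q : ZMod 3 × W ≃ α) (X : Finset α) (hX : ∀ a, q a ∈ X ↔ xc (st a.2) a.1 (S.p a.2) = true) :
    IsPerfectMatchingOn X ((prs q (eR S st c1) ∪ prs q (eR S st cm)) \ prs q (eR S st cs)) := by
  rw [prs_union, prs_sdiff]
  have : (fun s i a b => (c1 s i a b || cm s i a b) && !cs s i a b) = cc := by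
    funext s i a b
    exact cc_sd s i a b
  rw [this]
  have back : ∀ a b, eR S st cc b a → b = (a.1 + 2, a.2 + S.w) ∧
      cc (st a.2) (a.1 + 2) (!S.p a.2) (S.p a.2) = true := by
    rintro a ⟨j, y⟩ h
    rw [eR_iff S st cc cc_self] at h
    obtain ⟨rfl, h⟩ := h
    simp only [z12, w_w, hst, S.hp, Bool.not_not, true_and]
    exact h
  apply pm
  · intro a b h hab
    have := h.1
    rw [hab] at this
    exact (y01 _).1 this
  · intro a b h
    rw [eR_iff S st cc cc_self] at h
    obtain ⟨rfl, h⟩ := h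
    rw [hX, hX]
    simp only [hst, S.hp]
    exact cc_x _ _ _ h
  · intro a ha
    rw [hX] at ha
    rcases cc_ex _ _ _ ha with h | h
    · exact ⟨(a.1 + 1, a.2 + S.w), Or.inl ((eR_iff S st cc cc_self _ _).2 ⟨rfl, h⟩)⟩
    · refine ⟨(a.1 + 2, a.2 + S.w), Or.inr ((eR_iff S st cc cc_self _ _).2 ⟨?_, ?_⟩)⟩
      · simp only [z21, w_w]
      · simp only [hst, S.hp, Bool.not_not]
        exact h
  · intro a b c hb hc
    rcases hb with hb | hb <;> rcases hc with hc | hc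
    · rw [eR_iff S st cc cc_self] at hb hc
      rw [hb.1, hc.1]
    · rw [eR_iff S st cc cc_self] at hb
      exact (cc_un _ _ _ hb.2 (back _ _ hc).2).elim
    · rw [eR_iff S st cc cc_self] at hc
      exact (cc_un _ _ _ hc.2 (back _ _ hb).2).elim
    · rw [(back _ _ hb).1, (back _ _ hc).1]

open scoped Classical in
lemma card_D1 [Fintype W] (S : HS W) (st : W → Fin 3) (q : ZMod 3 × W ≃ α) :
    (prs q (eR S st c1) \ prs q (eR S st cs)).card =
      3 * (univ.filter fun x => S.p x = false ∧ st x = 1).card := by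
  rw [prs_sdiff]
  have : (fun s i a b => c1 s i a b && !cs s i a b) = c1' := by
    funext s i a b
    exact c1_sd s i a b
  rw [this, card_prs S st q _ c1'_self]
  have : (univ.filter fun a : ZMod 3 × W => c1' (st a.2) a.1 (S.p a.2) (!S.p a.2) = true) =
      (univ : Finset (ZMod 3)) ×ˢ (univ.filter fun x => S.p x = false ∧ st x = 1) := by
    ext ⟨i, x⟩
    simp only [mem_filter, mem_univ, true_and, mem_product, c1']
    cases hp : S.p x <;> simp [hp]
  rw [this, card_product]
  simp [ZMod.card]

open scoped Classical in
lemma card_Dm [Fintype W] (S : HS W) (st : W → Fin 3) (q : ZMod 3 × W ≃ α) :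
    (prs q (eR S st cm) \ prs q (eR S st cs)).card =
      3 * (univ.filter fun x => S.p x = true ∧ st x = 0).card +
        (univ.filter fun x => S.p x = true ∧ st x = 2).card := by
  rw [prs_sdiff]
  have : (fun s i a b => cm s i a b && !cs s i a b) = cm' := by
    funext s i a b
    exact cm_sd s i a b
  rw [this, card_prs S st q _ cm'_self]
  have : (univ.filter fun a : ZMod 3 × W => cm' (st a.2) a.1 (S.p a.2) (!S.p a.2) = true) =
      ((univ : Finset (ZMod 3)) ×ˢ (univ.filter fun x => S.p x = true ∧ st x = 0)) ∪
      (({2} : Finset (ZMod 3)) ×ˢ (univ.filter fun x => S.p x = true ∧ st x = 2)) := by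
    ext ⟨i, x⟩
    simp only [mem_filter, mem_univ, true_and, mem_product, cm', mem_union, mem_singleton]
    cases hp : S.p x <;> simp [hp]
    tauto
  rw [this, card_union_of_disjoint, card_product, card_product]
  · simp [ZMod.card]
  · rw [disjoint_left]
    rintro ⟨i, x⟩ h1 h2
    simp only [mem_filter, mem_univ, true_and, mem_product] at h1 h2
    rw [h1.2] at h2
    simp at h2

open scoped Classical in
lemma shape0 [Fintype W] (S : HS W) (st : W → Fin 3) (hst : ∀ x, st (x + S.w) = st x)
    (q : ZMod 3 × W ≃ α) (h2 : ∀ x, st x ≠ 2) (v h r t0 : ℕ) (e : ℤ) (hv : v = 6 * h)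
    (he : e = 3 * (-h + 2 * r)) (hh : r + t0 = h)
    (hr : (univ.filter fun x => S.p x = false ∧ st x = 1).card = r)
    (ht : (univ.filter fun x => S.p x = true ∧ st x = 0).card = t0) :
    ShapeD univ v e (prs q (eR S st c1)) (prs q (eR S st cm)) := by
  have hs : prs q (eR S st cs) = ∅ := by
    rw [eq_empty_iff_forall_notMem]
    intro T hT
    obtain ⟨a, b, h, -⟩ := (mem_prs _ _ _).1 hT
    have := h.2.2
    simp [cs, h2] at this
  have hm := pm_main S st hst q univ (fun a => by simp [xc, h2])
  have k1 := card_D1 S st q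
  have k2 := card_Dm S st q
  have k3 : (univ.filter fun x => S.p x = true ∧ st x = 2).card = 0 := by simp [h2]
  rw [hs, sdiff_empty] at hm k1 k2
  rw [hr] at k1
  rw [ht, k3] at k2
  left
  refine ⟨by omega, hm, ?_, ?_⟩
  · rw [k1]; push_cast; omega
  · rw [k2]; push_cast; omega

open scoped Classical in
lemma shape1 [Fintype W] (S : HS W) (st : W → Fin 3) (hst : ∀ x, st (x + S.w) = st x)
    (q : ZMod 3 × W ≃ α) (c0 : W) (hc0 : st c0 = 2) (hpc : S.p c0 = false)
    (h2 : ∀ x, st x = 2 → x = c0 ∨ x = c0 + S.w) (v h r t0 : ℕ) (e : ℤ) (hv : v = 6 * h)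
    (he : e = 3 * (-h + 2 * r + 1)) (hh : r + t0 + 1 = h)
    (hr : (univ.filter fun x => S.p x = false ∧ st x = 1).card = r)
    (ht : (univ.filter fun x => S.p x = true ∧ st x = 0).card = t0) :
    ShapeD univ v e (prs q (eR S st c1)) (prs q (eR S st cm)) := by
  have hpw : S.p (c0 + S.w) = true := by rw [S.hp, hpc]; rfl
  have hsw : st (c0 + S.w) = 2 := by rw [hst, hc0]
  have hcw : c0 ≠ c0 + S.w := by
    intro h; rw [← h, hpc] at hpw; simp at hpw
  have dw := S.dbl_w c0
  have k3 : (univ.filter fun x => S.p x = true ∧ st x = 2).card = 1 := by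
    rw [card_eq_one]
    refine ⟨c0 + S.w, ?_⟩
    ext x
    simp only [mem_filter, mem_univ, true_and, mem_singleton]
    constructor
    · rintro ⟨h1, h3⟩
      rcases h2 x h3 with rfl | rfl
      · rw [hpc] at h1; simp at h1
      · rfl
    · rintro rfl
      exact ⟨hpw, hsw⟩
  have k1 := card_D1 S st q
  have k2 := card_Dm S st q
  rw [hr] at k1
  rw [ht, k3] at k2
  have z0 : (2 : ZMod 3) + 1 = 0 := by decide
  have z1 : (1 : ZMod 3) + 1 = 2 := by decide
  have ne01 : (0 : ZMod 3) ≠ 1 := by decide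
  have ne02 : (0 : ZMod 3) ≠ 2 := by decide
  have ne12 : (1 : ZMod 3) ≠ 2 := by decide
  have hi : ∀ i : ZMod 3, i = 0 ∨ i = 1 ∨ i = 2 := by decide
  have star : prs q (eR S st cs) = {({q (2, c0), q (0, c0 + S.w)} : Finset α),
      {q (2, c0), q (1, c0)}, {q (2, c0), q (1, c0 + S.w)}} := by
    ext T
    simp only [mem_insert, mem_singleton]
    constructor
    · intro hT
      obtain ⟨⟨i, x⟩, ⟨j, y⟩, h, rfl⟩ := (mem_prs _ _ _).1 hT
      obtain ⟨h3, h4, h5⟩ := h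
      simp only [cs, Bool.and_eq_true, decide_eq_true_eq, Bool.or_eq_true, Bool.not_eq_true'] at h3 h4 h5
      obtain ⟨h5, ⟨rfl, h6⟩ | ⟨⟨rfl, h6⟩, h7⟩⟩ := h5
      · have hx := h2 x h5
        rw [z1] at h3
        subst h3
        have hy : y = c0 := by
          apply S.eq_of_p _ (by rw [h6, hpc])
          rw [← h4]
          rcases hx with rfl | rfl
          · rfl
          · exact dw
        subst hy
        rcases hx with rfl | rfl
        · right; left; exact pair_comm _ _
        · right; right; exact pair_comm _ _
      · have hx := h2 x h5
        rw [z0] at h3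
        subst h3
        have hx' : x = c0 := by
          rcases hx with rfl | rfl
          · rfl
          · rw [hpw] at h6; simp at h6
        subst hx'
        have hy : y = x + S.w := S.eq_of_p (by rw [← h4, dw]) (by rw [h7, hpw])
        subst hy
        left; rfl
    · rintro (rfl | rfl | rfl)
      · rw [mem_prs_pair]; left
        refine ⟨z0.symm, dw.symm, ?_⟩
        simp [cs, hc0, hpc, hpw]
      · rw [mem_prs_pair]; right
        refine ⟨z1.symm, rfl, ?_⟩
        simp [cs, hc0, hpc]
      · rw [mem_prs_pair]; right
        refine ⟨z1.symm, dw, ?_⟩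
        simp [cs, hsw, hpc]
  have hm := pm_main S st hst q
    (univ \ {q (2, c0), q (0, c0 + S.w), q (1, c0), q (1, c0 + S.w)}) (by
      rintro ⟨i, x⟩
      simp only [mem_sdiff, mem_univ, true_and, mem_insert, mem_singleton,
        EmbeddingLike.apply_eq_iff_eq, Prod.mk.injEq, xc]
      by_cases hx : st x = 2
      · rcases h2 x hx with rfl | rfl
        · rw [hpc]
          simp only [hcw, hc0, and_true, and_false]
          rcases hi i with rfl | rfl | rfl <;>
            simp [ne01, ne02, ne12, ne01.symm, ne02.symm, ne12.symm]
        · rw [hpw]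
          simp only [hcw.symm, hsw, and_true, and_false]
          rcases hi i with rfl | rfl | rfl <;>
            simp [ne01, ne02, ne12, ne01.symm, ne02.symm, ne12.symm]
      · have e1 : x ≠ c0 := by rintro rfl; exact hx hc0
        have e2 : x ≠ c0 + S.w := by rintro rfl; exact hx hsw
        simp [e1, e2, hx])
  -- membership of the star edges
  have d2 : ({q (2, c0), q (0, c0 + S.w)} : Finset α) ∈ prs q (eR S st c1) := by
    rw [mem_prs_pair]; left
    refine ⟨z0.symm, dw.symm, ?_⟩
    simp only [hc0, hpc, hpw]; decide
  have d3 : ({q (2, c0), q (1, c0)} : Finset α) ∈ prs q (eR S st c1) := by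
    rw [mem_prs_pair]; right
    refine ⟨z1.symm, rfl, ?_⟩
    simp only [hc0, hpc]; decide
  have d4 : ({q (2, c0), q (1, c0 + S.w)} : Finset α) ∈ prs q (eR S st cm) := by
    rw [mem_prs_pair]; right
    refine ⟨z1.symm, dw, ?_⟩
    simp only [hsw, hpc, hpw]; decide
  have disj : ∀ T, T ∈ prs q (eR S st c1) → T ∉ prs q (eR S st cm) := by
    intro T hT
    obtain ⟨a, b, h, rfl⟩ := (mem_prs _ _ _).1 hT
    rw [mem_prs_pair]
    rintro (h' | h')
    · exact c1_cm _ _ _ _ h.2.2 h'.2.2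
    · exact eR_asymm S st _ _ _ _ h h'
  have f2 := disj _ d2
  have f3 := disj _ d3
  have f4 : ({q (2, c0), q (1, c0 + S.w)} : Finset α) ∉ prs q (eR S st c1) :=
    fun h => disj _ h d4
  rw [star] at hm k1 k2
  right
  refine ⟨by omega, q (2, c0), q (0, c0 + S.w), q (1, c0), q (1, c0 + S.w), _,
    mem_univ _, mem_univ _, mem_univ _, mem_univ _, ?_, ?_, ?_, ?_, ?_, ?_, rfl, ?_, hm,
    Or.inl ⟨?_, ?_, ?_, ?_⟩⟩
  · simp [ne02.symm]
  · simp [ne12.symm]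
  · simp [ne12.symm]
  · simp [ne01]
  · simp [ne01]
  · simpa using hcw
  · intro T
    simp only [mem_insert, mem_singleton, mem_union]
    rintro (rfl | rfl | rfl)
    · exact Or.inl d2
    · exact Or.inl d3
    · exact Or.inr d4
  · rw [insert_inter_of_mem d2, insert_inter_of_mem d3, singleton_inter_of_notMem f4]
    rw [insert_empty_eq]
    apply card_pair
    intro h
    rcases pair_q q _ _ _ _ h with h | h
    · simp [ne01] at h
    · simp [ne12.symm] at h
  · rw [insert_inter_of_notMem f2, insert_inter_of_notMem f3, singleton_inter_of_mem d4]
    simp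
  · rw [k1]; push_cast; omega
  · rw [k2]; push_cast; omega

end shape

/-! ### Part 6: the cyclic group and the families -/

section concrete

lemma zval_lt (h : ℕ) (hh : 0 < h) (x : ZMod (2 * h)) : x.val < 2 * h := by
  haveI : NeZero (2 * h) := ⟨by omega⟩
  exact x.val_lt

lemma zcast (h : ℕ) (hh : 0 < h) (x : ZMod (2 * h)) : ((x.val : ℕ) : ZMod (2 * h)) = x := by
  haveI : NeZero (2 * h) := ⟨by omega⟩
  exact ZMod.natCast_zmod_val x

lemma zval_cast (h m : ℕ) (hm : m < 2 * h) : ((m : ℕ) : ZMod (2 * h)).val = m :=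
  ZMod.val_cast_of_lt hm

lemma zval_add_w (h : ℕ) (hh : 0 < h) (x : ZMod (2 * h)) :
    (x + (h : ZMod (2 * h))).val = if x.val < h then x.val + h else x.val - h := by
  have hx := zval_lt h hh x
  split_ifs with hlt
  · rw [← zval_cast h (x.val + h) (by omega)]
    congr 1
    push_cast
    rw [zcast h hh]
  · rw [← zval_cast h (x.val - h) (by omega)]
    congr 1
    have e : ((x.val - h + h + h : ℕ) : ZMod (2 * h)) = ((x.val - h : ℕ) : ZMod (2 * h)) := by
      rw [add_assoc, ← two_mul, Nat.cast_add, ZMod.natCast_self, add_zero]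
    rw [← e, show x.val - h + h + h = x.val + h by omega]
    push_cast
    rw [zcast h hh]

/-- the concrete structure -/
def hsZ (h : ℕ) (hh : 0 < h) : HS (ZMod (2 * h)) where
  o := 1
  w := (h : ZMod (2 * h))
  p z := decide (h ≤ z.val)
  hww := by
    rw [← Nat.cast_add, ← two_mul, ZMod.natCast_self]
  hw := by
    rw [Ne, ZMod.natCast_eq_zero_iff]
    intro hd
    have := Nat.le_of_dvd hh hd
    omega
  hker := by
    intro x hx
    have hv := zval_lt h hh x
    rw [← zcast h hh x, ← Nat.cast_add, ← two_mul, ZMod.natCast_eq_zero_iff] at hx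
    have hd : h ∣ x.val := Nat.dvd_of_mul_dvd_mul_left (by omega) hx
    obtain ⟨k, hk⟩ := hd
    have hk2 : k < 2 := by
      by_contra hc
      have : h * 2 ≤ h * k := Nat.mul_le_mul_left h (by omega)
      omega
    rw [← zcast h hh x, hk]
    interval_cases k
    · left; simp
    · right; simp
  ho := by
    intro x hx
    have e : ((x.val + x.val : ℕ) : ZMod (2 * h)) = ((1 : ℕ) : ZMod (2 * h)) := by
      push_cast
      rw [zcast h hh, hx]
    rw [ZMod.natCast_eq_natCast_iff] at e
    have e2 : x.val + x.val ≡ 1 [MOD 2] := Nat.ModEq.of_mul_right h e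
    unfold Nat.ModEq at e2
    omega
  hcov := by
    intro u
    refine ⟨((u.val / 2 : ℕ) : ZMod (2 * h)), ?_⟩
    rcases Nat.mod_two_eq_zero_or_one u.val with hm | hm
    · left
      rw [← Nat.cast_add, show u.val / 2 + u.val / 2 = u.val by omega, zcast h hh]
    · right
      rw [← Nat.cast_add, ← Nat.cast_one (R := ZMod (2 * h)), ← Nat.cast_add,
        show u.val / 2 + u.val / 2 + 1 = u.val by omega, zcast h hh]
  hp := by
    intro z
    have hv := zval_lt h hh z
    rw [zval_add_w h hh]
    by_cases hz : z.val < h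
    · have h2 : ¬ h ≤ z.val := by omega
      simp [hz]
    · have h2 : h ≤ z.val := by omega
      have h3 : ¬ h ≤ z.val - h := by omega
      simp [hz, h2, h3]

lemma zcount (h : ℕ) (hh : 0 < h) (a b : ℕ) (hb : b ≤ 2 * h) [Fintype (ZMod (2 * h))] :
    (univ.filter fun x : ZMod (2 * h) => a ≤ x.val ∧ x.val < b).card = b - a := by
  rw [← Nat.card_Ico]
  apply card_bij (fun x _ => x.val)
  · intro x hx
    simpa using hx
  · intro x _ y _ hxy
    rw [← zcast h hh x, hxy, zcast h hh]
  · intro m hm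
    rw [mem_Ico] at hm
    refine ⟨(m : ZMod (2 * h)), ?_, zval_cast h m (by omega)⟩
    rw [mem_filter, zval_cast h m (by omega)]
    exact ⟨mem_univ _, hm⟩

/-- reduction modulo `h` -/
def red (h m : ℕ) : ℕ := if m < h then m else m - h

/-- status function -/
def stZ (h r u : ℕ) (x : ZMod (2 * h)) : Fin 3 :=
  if red h x.val < r then 1 else if red h x.val < u then 2 else 0

lemma stZ_w (h : ℕ) (hh : 0 < h) (r u : ℕ) (x : ZMod (2 * h)) :
    stZ h r u (x + (hsZ h hh).w) = stZ h r u x := by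
  have hv := zval_lt h hh x
  have : red h (x + (hsZ h hh).w).val = red h x.val := by
    change red h (x + (h : ZMod (2 * h))).val = _
    rw [zval_add_w h hh]
    unfold red
    split_ifs <;> omega
  unfold stZ
  rw [this]

open scoped Classical in
lemma shapeZ (h : ℕ) (hh : 0 < h) [Fintype (ZMod (2 * h))] [Fintype α]
    (q : ZMod 3 × ZMod (2 * h) ≃ α) (v : ℕ)
    (hv : v = 6 * h) (f : ℤ) (hf1 : -(h : ℤ) < f) (hf2 : f < h) :
    ∃ st : ZMod (2 * h) → Fin 3, (∀ x, st (x + (hsZ h hh).w) = st x) ∧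
      ShapeD univ v (3 * f) (prs q (eR (hsZ h hh) st c1)) (prs q (eR (hsZ h hh) st cm)) := by
  obtain ⟨n, hn⟩ : ∃ n : ℕ, f + h = n := ⟨(f + h).toNat, by omega⟩
  obtain ⟨r, hr⟩ : ∃ r : ℕ, r = n / 2 := ⟨_, rfl⟩
  obtain ⟨u, hu⟩ : ∃ u : ℕ, u = r + n % 2 := ⟨_, rfl⟩
  have hp : ∀ x, (hsZ h hh).p x = decide (h ≤ x.val) := fun x => rfl
  have c1 : (univ.filter fun x => (hsZ h hh).p x = false ∧ stZ h r u x = 1).card = r := by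
    have hz := zcount h hh 0 r (by omega)
    rw [Nat.sub_zero] at hz
    refine Eq.trans ?_ hz
    congr 1
    ext x
    have hv := zval_lt h hh x
    simp only [mem_filter, mem_univ, true_and, hp, decide_eq_false_iff_not, stZ, red]
    split_ifs <;> simp <;> omega
  have c2 : (univ.filter fun x => (hsZ h hh).p x = true ∧ stZ h r u x = 0).card = h - u := by
    rw [show h - u = 2 * h - (h + u) by omega, ← zcount h hh (h + u) (2 * h) le_rfl]
    congr 1
    ext x
    have hv := zval_lt h hh x
    simp only [mem_filter, mem_univ, true_and, hp, decide_eq_true_eq, stZ, red]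
    split_ifs <;> simp <;> omega
  refine ⟨stZ h r u, stZ_w h hh r u, ?_⟩
  rcases Nat.mod_two_eq_zero_or_one n with hm | hm
  · refine shape0 (hsZ h hh) _ (stZ_w h hh r u) q ?_ v h r (h - u) _ hv (by omega) (by omega) c1 c2
    intro x
    unfold stZ
    split_ifs
    · decide
    · omega
    · decide
  · have e2 : (((r : ℕ) : ZMod (2 * h))).val = r := zval_cast h r (by omega)
    refine shape1 (hsZ h hh) _ (stZ_w h hh r u) q ((r : ℕ) : ZMod (2 * h)) ?_ ?_ ?_ v h r (h - u) _
      hv (by omega) (by omega) c1 c2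
    · unfold stZ red
      rw [e2]
      rw [if_pos (show r < h by omega), if_neg (by omega), if_pos (by omega)]
    · rw [hp, e2]
      simp; omega
    · intro x hx
      have hv := zval_lt h hh x
      have key : red h x.val = r := by
        unfold stZ at hx
        split_ifs at hx
        · simp at hx
        · omega
        · exact absurd hx (by decide)
      unfold red at key
      split_ifs at key with h1
      · left
        rw [← key, zcast h hh]
      · right
        change x = _ + ((h : ℕ) : ZMod (2 * h))
        rw [← Nat.cast_add, ← key, Nat.sub_add_cancel (by omega), zcast h hh]

/-- the assembly of the system from twofold designs -/
lemma assemble (h : ℕ) (hh : 0 < h) (K : ℕ)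
    (E : ℕ → (ZMod 3 × ZMod (2 * h)) → (ZMod 3 × ZMod (2 * h)) → (ZMod 3 × ZMod (2 * h)) → Prop)
    (hE : ∀ k < K, SymR (E k)) (hE2 : ∀ k < K, ∀ a b, a ≠ b → {c | E k a b c}.ncard = 2)
    (hx : ∀ j < K, ∀ k < K, j ≠ k → ∀ a b c, E j a b c → ¬ E k a b c)
    (hNx : ∀ st, ∀ k < K, ∀ a b c, NR (hsZ h hh) st a b c → ¬ E k a b c)
    (f : ℤ) (hf1 : -(h : ℤ) < f) (hf2 : f < h) :
    GoodSys (Fin (6 * h)) (6 * h) (2 * K + 1) (3 * f) := by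
  classical
  haveI : NeZero (2 * h) := ⟨by omega⟩
  have hc : Fintype.card (ZMod 3 × ZMod (2 * h)) = 6 * h := by
    rw [Fintype.card_prod, ZMod.card, ZMod.card]; ring
  let q : ZMod 3 × ZMod (2 * h) ≃ Fin (6 * h) := Fintype.equivFinOfCardEq hc
  obtain ⟨st, hst, hs⟩ := shapeZ h hh q (6 * h) rfl f hf1 hf2
  have sub : ∀ g, prs q (eR (hsZ h hh) st g) ⊆ powersetCard 2 univ := by
    intro g T hT
    obtain ⟨a, b, hab, rfl⟩ := (mem_prs _ _ _).1 hT
    rw [mem_powersetCard]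
    refine ⟨subset_univ _, card_pair ?_⟩
    intro he
    have h1 := hab.1
    rw [q.injective he] at h1
    exact (y01 _).1 h1
  refine good_of_rel q (6 * h) (3 * f) (NR (hsZ h hh) st) E K (NR_symR _ st) hE hE2 hx (hNx st)
    (prs q (eR (hsZ h hh) st c1)) (prs q (eR (hsZ h hh) st cm)) (sub _) (sub _) ?_ ?_ hs
  · rw [disjoint_left]
    intro T hT
    obtain ⟨a, b, h, rfl⟩ := (mem_prs _ _ _).1 hT
    rw [mem_prs_pair]
    rintro (h' | h')
    · exact c1_cm _ _ _ _ h.2.2 h'.2.2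
    · exact eR_asymm _ st _ _ _ _ h h'
  · intro a b hab
    rw [NR_count _ st hst a b hab]
    simp only [mem_prs_pair]

/-- a triple as a function of the level -/
def tri (a b c : ℕ) (i : ZMod 3) : ℕ := if i = 0 then a else if i = 1 then b else c

lemma tri_forall (P : ℕ → ℕ → Prop) (a b c a' b' c' : ℕ) (h0 : P a a') (h1 : P b b')
    (h2 : P c c') (i : ZMod 3) : P (tri a b c i) (tri a' b' c' i) := by
  unfold tri
  split_ifs <;> assumption

/-- a family of shifts -/
structure Fam (h n : ℕ) (t : ℕ → ZMod 3 → ℕ) : Prop where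
  lt : ∀ k < n, ∀ i, t k i < h
  inj : ∀ j < n, ∀ k < n, j ≠ k → ∀ i, t j i ≠ t k i
  sum : ∀ k < n, t k 0 + t k 1 + t k 2 = h ∨ t k 0 + t k 1 + t k 2 = 2 * h

/-- doubled shifts -/
def dd (h : ℕ) (t : ZMod 3 → ℕ) (i : ZMod 3) : ZMod (2 * h) := (t i : ZMod (2 * h)) + t i

lemma dd_ne (h a b : ℕ) (ha : a < h) (hb : b < h) (hab : a ≠ b) :
    ((a : ZMod (2 * h)) + a) ≠ (b : ZMod (2 * h)) + b := by
  intro he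
  rw [← Nat.cast_add, ← Nat.cast_add] at he
  have := congrArg ZMod.val he
  rw [zval_cast h _ (by omega), zval_cast h _ (by omega)] at this
  omega

lemma dd_sum (h : ℕ) (t : ZMod 3 → ℕ) (hs : t 0 + t 1 + t 2 = h ∨ t 0 + t 1 + t 2 = 2 * h)
    (i : ZMod 3) : dd h t i + dd h t (i + 1) + dd h t (i + 2) = 0 := by
  have key : dd h t 0 + dd h t 1 + dd h t 2 = 0 := by
    unfold dd
    have : ((t 0 : ZMod (2 * h)) + t 0 + (t 1 + t 1) + (t 2 + t 2)) =
        ((2 * (t 0 + t 1 + t 2) : ℕ) : ZMod (2 * h)) := by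
      push_cast; ring
    rw [this]
    rcases hs with hs | hs
    · rw [hs, ZMod.natCast_self]
    · rw [hs, Nat.cast_mul, ZMod.natCast_self, mul_zero]
  have hi : i = 0 ∨ i = 1 ∨ i = 2 := by revert i; decide
  rcases hi with rfl | rfl | rfl
  · rw [show (0 : ZMod 3) + 1 = 1 by decide, show (0 : ZMod 3) + 2 = 2 by decide]
    exact key
  · rw [show (1 : ZMod 3) + 1 = 2 by decide, show (1 : ZMod 3) + 2 = 0 by decide, ← key]
    ring
  · rw [show (2 : ZMod 3) + 1 = 0 by decide, show (2 : ZMod 3) + 2 = 1 by decide, ← key]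
    ring

lemma from_fam (h : ℕ) (hh : 0 < h) (K nA nB : ℕ) (hK : K ≤ nA + nB) (tA tB : ℕ → ZMod 3 → ℕ)
    (hA : Fam h nA tA) (hB : Fam h nB tB) (h0 : ∀ k < nA, ∀ i, tA k i ≠ 0)
    (f : ℤ) (hf1 : -(h : ℤ) < f) (hf2 : f < h) :
    GoodSys (Fin (6 * h)) (6 * h) (2 * K + 1) (3 * f) := by
  refine assemble h hh K (fun k => if k < nA then EA (hsZ h hh) (dd h (tA k)) false
    else EB (hsZ h hh) (dd h (tB (k - nA)))) ?_ ?_ ?_ ?_ f hf1 hf2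
  · intro k hk
    beta_reduce
    split_ifs
    · exact EA_symR _ _ _
    · exact EB_symR _ _
  · intro k hk a b hab
    beta_reduce
    split_ifs with hkA
    · exact EA_count _ _ (fun i => (tA k i : ZMod (2 * h))) _ (fun i => rfl)
        (dd_sum h _ (hA.sum k hkA)) a b hab
    · exact EB_count _ _ (fun i => (tB (k - nA) i : ZMod (2 * h))) (fun i => rfl)
        (dd_sum h _ (hB.sum (k - nA) (by omega))) a b hab
  · intro j hj k hk hjk a b c
    beta_reduce
    by_cases h1 : j < nA <;> by_cases h2 : k < nA <;> simp only [h1, h2, if_true, if_false]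
    · exact EA_disj _ _ (fun i => (tA j i : ZMod (2 * h))) _ (fun i => (tA k i : ZMod (2 * h))) _
        (fun i => rfl) (fun i => rfl)
        (fun i => dd_ne h _ _ (hA.lt j h1 i) (hA.lt k h2 i) (hA.inj j h1 k h2 hjk i)) a b c
    · exact EA_EB_disj _ _ _ a b c
    · intro h3 h4
      exact EA_EB_disj _ _ _ a b c h4 h3
    · exact EB_disj _ _ (fun i => (tB (j - nA) i : ZMod (2 * h))) _
        (fun i => (tB (k - nA) i : ZMod (2 * h)))
        (fun i => rfl) (fun i => rfl)
        (fun i => dd_ne h _ _ (hB.lt _ (by omega) i) (hB.lt _ (by omega) i)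
          (hB.inj _ (by omega) _ (by omega) (by omega) i)) a b c
  · intro st k hk a b c
    have z : ∀ m, m < h → m ≠ 0 → ((m : ZMod (2 * h)) + m) ≠ 0 := by
      intro m hm hm0
      have := dd_ne h m 0 hm hh hm0
      simpa using this
    by_cases h1 : k < nA <;> simp only [h1, if_true, if_false]
    · exact NR_EA_disj _ st _ (fun i => (tA k i : ZMod (2 * h))) (fun i => rfl)
        (fun i => z _ (hA.lt k h1 i) (h0 k h1 i)) _ a b c
    · have hs := hB.sum (k - nA) (by omega)
      have : ∃ i, tB (k - nA) i ≠ 0 := by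
        by_contra hc
        push Not at hc
        rw [hc, hc, hc] at hs
        omega
      obtain ⟨i, hi⟩ := this
      exact NR_EB_disj _ st _ i (z _ (hB.lt _ (by omega) i) hi) a b c

lemma odd_case (h : ℕ) (ho : h % 2 = 1) (K : ℕ) (hK : 2 * K + 2 ≤ 3 * h)
    (f : ℤ) (hf1 : -(h : ℤ) < f) (hf2 : f < h) :
    GoodSys (Fin (6 * h)) (6 * h) (2 * K + 1) (3 * f) := by
  have hF : Fam h (h - 1) (fun k => tri (k + 1) (k + 1)
      (if 2 * (k + 1) < h then h - 2 * (k + 1) else 2 * h - 2 * (k + 1))) := by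
    constructor
    · intro k hk i
      unfold tri
      split_ifs <;> omega
    · intro j hj k hk hjk i
      apply tri_forall (fun a b => a ≠ b)
      · omega
      · omega
      · split_ifs <;> omega
    · intro k hk
      change (k + 1) + (k + 1) + (if 2 * (k + 1) < h then h - 2 * (k + 1) else 2 * h - 2 * (k + 1)) = h ∨
        (k + 1) + (k + 1) + (if 2 * (k + 1) < h then h - 2 * (k + 1) else 2 * h - 2 * (k + 1)) = 2 * h
      split_ifs <;> omega
  refine from_fam h (by omega) K (h - 1) (h - 1) (by omega) _ _ hF hF ?_ f hf1 hf2
  intro k hk i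
  unfold tri
  split_ifs <;> omega

lemma even_case (h : ℕ) (ho : h % 2 = 0) (h4 : 4 ≤ h) (K : ℕ) (hK : 2 * K + 2 ≤ 3 * h)
    (f : ℤ) (hf1 : -(h : ℤ) < f) (hf2 : f < h) :
    GoodSys (Fin (6 * h)) (6 * h) (2 * K + 1) (3 * f) := by
  have hA : Fam h (h - 2) (fun k => tri (k + 1) (if 2 * (k + 1) < h then k + 1 else k + 2)
      (if 2 * (k + 1) < h then h - 2 * (k + 1) else 2 * h - 2 * (k + 1) - 1)) := by
    constructor
    · intro k hk i
      unfold tri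
      split_ifs <;> omega
    · intro j hj k hk hjk i
      apply tri_forall (fun a b => a ≠ b)
      · omega
      · split_ifs <;> omega
      · split_ifs <;> omega
    · intro k hk
      change (k + 1) + (if 2 * (k + 1) < h then k + 1 else k + 2) +
          (if 2 * (k + 1) < h then h - 2 * (k + 1) else 2 * h - 2 * (k + 1) - 1) = h ∨
        (k + 1) + (if 2 * (k + 1) < h then k + 1 else k + 2) +
          (if 2 * (k + 1) < h then h - 2 * (k + 1) else 2 * h - 2 * (k + 1) - 1) = 2 * h
      split_ifs <;> omega
  have hB : Fam h (h - 1) (fun k => tri (k + 1) (if 2 * k < h then k else k + 1)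
      (if 2 * k < h then h - 2 * k - 1 else 2 * h - 2 * k - 2)) := by
    constructor
    · intro k hk i
      unfold tri
      split_ifs <;> omega
    · intro j hj k hk hjk i
      apply tri_forall (fun a b => a ≠ b)
      · omega
      · split_ifs <;> omega
      · split_ifs <;> omega
    · intro k hk
      change (k + 1) + (if 2 * k < h then k else k + 1) +
          (if 2 * k < h then h - 2 * k - 1 else 2 * h - 2 * k - 2) = h ∨
        (k + 1) + (if 2 * k < h then k else k + 1) +
          (if 2 * k < h then h - 2 * k - 1 else 2 * h - 2 * k - 2) = 2 * h
      split_ifs <;> omega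
  refine from_fam h (by omega) K (h - 2) (h - 1) (by omega) _ _ hA hB ?_ f hf1 hf2
  intro k hk i
  unfold tri
  split_ifs <;> omega

end concrete

/-! ### Part 7: twelve points -/

section twelve

/-- the two twofold triple systems on twelve points, as bit masks -/
def mask (k : ℕ) : ℕ := if k = 0 then
  86590895645293894299604128806294228129548036879897210838631226946580943776045932178817742234535909147048215980963552244445369203689006002273617866371600833942234356304892747854337197242865643760781528885444485939663987436053303819413268116768214076663918795882020942258866325866684751759804764372824556743985409753998194792278745011103674906386197123445177777275213441255062304027181622067822389936032822165621933663977017476675236118914676075447797683369678256092527761692843273029548639088238318977655007477760000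
  else
  692868092799290249880239248771464312252219118327785403188044508914809944588995615315111439145518230433455218449715771398854582502837404379448543479039056258894969996776418722005040422142746149168348380860669937731212994704485700598949900646878347296476610112445711563447199164999577757592666252301907317927000852636680731697602169512688885203548175179378034529236915197206700001262512790326718873254852456036326864727453646544288629104207288482462583061230711759402041732680948294434797047120383250642021742962278400

/-- number of a point -/
def code (a : ZMod 3 × ZMod 4) : ℕ := 4 * a.1.val + a.2.val

/-- the block relation -/
def E12 (k : ℕ) (a b c : ZMod 3 × ZMod 4) : Bool :=
  (mask k).testBit (code a * 144 + code b * 12 + code c)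

lemma E12_sym : ∀ k < 2, ∀ a b c, E12 k a b c = true →
    E12 k b a c = true ∧ E12 k a c b = true ∧ a ≠ b := by
  decide +kernel

lemma E12_count : ∀ k < 2, ∀ a b, a ≠ b → (univ.filter fun c => E12 k a b c = true).card = 2 := by
  decide +kernel

lemma E12_disj : ∀ a b c, ¬ (E12 0 a b c = true ∧ E12 1 a b c = true) := by
  decide +kernel

lemma E12_N : ∀ k < 2, ∀ (i : ZMod 3) (x y z : ZMod 4), x ≠ y →
    (z + z + if decide (2 ≤ z.val) = true then 1 else 0) = x + y →
    ¬ E12 k (i, x) (i, y) (i + 1, z) = true := by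
  decide +kernel

lemma E12_H : ∀ k < 2, ∀ (i : ZMod 3) (x y z : ZMod 4) (s : Fin 3), x + x = y + y → x + x = z + z →
    Qh s i (decide (2 ≤ x.val)) (decide (2 ≤ y.val)) (decide (2 ≤ z.val)) = true →
    ¬ E12 k (i, x) (i + 1, y) (i + 2, z) = true := by
  decide +kernel

lemma E12_symR (k : ℕ) (hk : k < 2) : SymR fun a b c => E12 k a b c = true where
  s1 a b c h := (E12_sym k hk a b c h).1
  s2 a b c h := (E12_sym k hk a b c h).2.1
  ne a b c h := (E12_sym k hk a b c h).2.2

lemma two_case (K : ℕ) (hK : K ≤ 2) (f : ℤ) (hf1 : -((2 : ℕ) : ℤ) < f) (hf2 : f < (2 : ℕ)) :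
    GoodSys (Fin (6 * 2)) (6 * 2) (2 * K + 1) (3 * f) := by
  refine assemble 2 (by omega) K (fun k a b c => E12 k a b c = true) ?_ ?_ ?_ ?_ f hf1 hf2
  · intro k hk
    exact E12_symR k (by omega)
  · intro k hk a b hab
    exact (ncard_filter' (fun c : ZMod 3 × ZMod 4 => E12 k a b c = true)).trans
      (E12_count k (by omega) a b hab)
  · intro j hj k hk hjk a b c h1 h2
    have hj2 : j = 0 ∨ j = 1 := by omega
    have hk2 : k = 0 ∨ k = 1 := by omega
    rcases hj2 with rfl | rfl <;> rcases hk2 with rfl | rfl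
    · exact hjk rfl
    · exact E12_disj a b c ⟨h1, h2⟩
    · exact E12_disj a b c ⟨h2, h1⟩
    · exact hjk rfl
  · intro st k hk a b c hN
    refine sym3_disj (E12_symR k (by omega)) ?_ a b c hN
    rintro ⟨i, x⟩ ⟨j, y⟩ ⟨l, z⟩ (⟨h1, h2, h3, h4⟩ | ⟨h1, h2, h3, h4, h5⟩)
    · change i = j at h1
      change l = i + 1 at h2
      subst h1 h2
      exact E12_N k (by omega) i x y z h3 h4
    · change j = i + 1 at h1
      change l = i + 2 at h2
      subst h1 h2
      exact E12_H k (by omega) i x y z (st x) h3 h4 h5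

end twelve


/-- NWBTS(v;b) exists for v ≡ 0 (mod 6) under (C2). -/
theorem stmt_14 (v b : ℕ) (hv : v % 6 = 0) (hC2 : CondC2 v b) :
    ∃ F : Multiset (Finset (Fin v)), IsNWBTSOn Finset.univ v b F := by
  obtain ⟨h, rfl⟩ : ∃ h, v = 6 * h := ⟨v / 6, by omega⟩
  refine reduction h (6 * h) b rfl hC2 ?_
  intro l f hl hl3 hf1 hf2
  obtain ⟨K, rfl⟩ : ∃ K, l = 2 * K + 1 := ⟨l / 2, by omega⟩
  rcases Nat.mod_two_eq_zero_or_one h with ho | ho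
  · by_cases h4 : 4 ≤ h
    · exact even_case h ho h4 K (by omega) f hf1 hf2
    · have h2 : h = 2 := by omega
      subst h2
      exact two_case K (by omega) f hf1 hf2
  · exact odd_case h ho K (by omega) f hf1 hf2

end DataPlacement
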